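/- arXiv:2503.14285 — 2 statements merged into one kernel-verified Lean document; each statement's English description precedes it below -/
import Mathlib

section
/- Let q = p^d where p is an odd prime, and let M be a regular matroid without coloops on a finite ground set E. For each α ∈ (𝔽_q^*)^E, let A*_⊥(α) ⊆ E be any subset of maximum cardinality among subsets A with s(M.A;α) ≠ 0. Then, as an identity in ℚ, χ_{M✶}(q) = ∑_{α ∈ (𝔽_q^*)^E} g(q, r(M.A*_⊥(α))) · η( s(M.A*_⊥(α); α) ), where r(M.A) = r(E) − r(E∖A) is the rank of the contraction M.A. -/
/-!
STATEMENT 1: α-representation for the characteristic polynomial of the dual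
of a regular matroid without coloops (Theorem 3 of the paper).
-/

namespace AlphaRepr

/-- A matroid on a finite ground set `E`, given by its rank function. -/
structure Matroid (E : Type) [Fintype E] [DecidableEq E] where
  r : Finset E → ℕ
  r_le_card : ∀ A : Finset E, r A ≤ A.card
  r_mono : ∀ ⦃A B : Finset E⦄, A ⊆ B → r A ≤ r B
  r_submod : ∀ A B : Finset E, r (A ∪ B) + r (A ∩ B) ≤ r A + r B

variable {E : Type} [Fintype E] [DecidableEq E]

/-- The bases of the contraction `M.A = M/(E∖A)`: sets `B ⊆ A` with
`r_{M.A}(B) = |B|` (i.e. `r(B ∪ Aᶜ) = |B| + r(Aᶜ)`) and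
`r_{M.A}(B) = r_{M.A}(A)` (i.e. `r(B ∪ Aᶜ) = r(E)`). -/
def contrBases (M : Matroid E) (A : Finset E) : Finset (Finset E) :=
  A.powerset.filter fun B =>
    M.r (B ∪ Aᶜ) = B.card + M.r Aᶜ ∧ M.r (B ∪ Aᶜ) = M.r Finset.univ

/-- `s(M.A;α) = ∑_{B base of M.A} ∏_{e ∈ B} α_e`. -/
def sContr {F : Type} [Field F] (M : Matroid E) (A : Finset E) (α : E → F) : F :=
  ∑ B ∈ contrBases M A, ∏ e ∈ B, α e

/-- The rank function of the dual matroid `M✶`: `r✶(A) = r(E∖A) + |A| − r(E)`. -/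
def dualR (M : Matroid E) (A : Finset E) : ℕ :=
  M.r Aᶜ + A.card - M.r Finset.univ

/-- An element `e` is a coloop of `M` iff it is a loop of `M✶`,
equivalently `r(E∖{e}) ≠ r(E)`. -/
def IsColoop (M : Matroid E) (e : E) : Prop :=
  M.r ({e} : Finset E)ᶜ ≠ M.r Finset.univ

/-- The value of the characteristic polynomial
`χ(x) = ∑_{A ⊆ E} (−1)^{|A|} x^{ρ(E) − ρ(A)}` of the rank function `ρ` at `x`. -/
def charPolyVal (ρ : Finset E → ℕ) (x : ℚ) : ℚ :=
  ∑ A : Finset E, (-1 : ℚ) ^ A.card * x ^ (ρ Finset.univ - ρ A)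

/-- `M` is representable over a field `F`. -/
def Representable (M : Matroid E) (F : Type) [Field F] : Prop :=
  ∃ (n : ℕ) (A : Matrix (Fin n) E F),
    ∀ S : Finset E, M.r S = (A.submatrix id (fun x : S => (x : E))).rank

/-- `M` is regular: representable over every field. -/
def Regular (M : Matroid E) : Prop :=
  ∀ (F : Type) [Field F], Representable M F

/-- `g(q,m) = η(−1)^{m/2} q^{−m/2}` for even `m`, `g(q,m) = 0` for odd `m`. -/
noncomputable def g (F : Type) [Field F] [Fintype F] [DecidableEq F] (m : ℕ) : ℚ :=
  if Even m then
    ((quadraticChar F (-1) : ℤ) : ℚ) ^ (m / 2) * ((Fintype.card F : ℚ))⁻¹ ^ (m / 2)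
  else 0

set_option linter.unusedSectionVars false

open Matrix

theorem det_eq_mul_det_schur {R : Type*} [CommRing R] {k : ℕ}
    (A : Matrix (Fin (k + 1)) (Fin (k + 1)) R) (h : A 0 0 * A 0 0 = 1) :
    A.det = A 0 0 * (Matrix.of fun i j : Fin k =>
      A i.succ j.succ - A 0 0 * A i.succ 0 * A 0 j.succ).det := by
  let B : Matrix (Fin (k + 1)) (Fin (k + 1)) R := Matrix.of
    fun i j => Fin.cases (A 0 j) (fun i' => A i'.succ j - A 0 0 * A i'.succ 0 * A 0 j) i
  have hAB : A.det = B.det := by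
    refine det_eq_of_forall_row_eq_smul_add_const
      (Fin.cases 0 fun i' => A 0 0 * A i'.succ 0) 0 (by simp) fun i j => ?_
    refine Fin.cases ?_ (fun i' => ?_) i
    · simp [B]
    · simp [B]
  rw [hAB, det_succ_column_zero, Fin.sum_univ_succ, Finset.sum_eq_zero, add_zero]
  · simp only [B, of_apply, Fin.cases_zero, Fin.val_zero, pow_zero, one_mul]
    rfl
  · intro i _
    have : B i.succ 0 = 0 := by
      simp only [B, of_apply, Fin.cases_succ]
      linear_combination (-A i.succ 0) * h
    simp [this]

theorem abs_det_le_one_of_two_dvd_iff_three_dvd : ∀ (k : ℕ) (A : Matrix (Fin k) (Fin k) ℤ),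
    (∀ i j, |A i j| ≤ 1) →
    (∀ (m : ℕ) (f g : Fin m → Fin k),
      2 ∣ (A.submatrix f g).det ↔ 3 ∣ (A.submatrix f g).det) →
    |A.det| ≤ 1 := by
  intro k
  induction k with
  | zero => intro A _ _; simp
  | succ k ih =>
    intro A hA hdvd
    by_cases hcol : ∀ i, A i 0 = 0
    · rw [det_eq_zero_of_column_eq_zero 0 hcol]; simp
    push Not at hcol
    obtain ⟨i₀, hi₀⟩ := hcol
    let P := A.submatrix (Equiv.swap 0 i₀) id
    have hdet : |P.det| = |A.det| := by
      rw [show P.det = _ from det_permute _ _, abs_mul]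
      rcases Int.units_eq_one_or (Equiv.Perm.sign (Equiv.swap 0 i₀)) with h | h <;> simp [h]
    have hP : ∀ i j, |P i j| ≤ 1 := fun i j => hA _ _
    have hPd : ∀ (m : ℕ) (f g : Fin m → Fin (k + 1)),
        2 ∣ (P.submatrix f g).det ↔ 3 ∣ (P.submatrix f g).det := fun m f g =>
      hdvd m (Equiv.swap 0 i₀ ∘ f) g
    have h00 : P 0 0 ≠ 0 := by simpa [P] using hi₀
    have hpiv : P 0 0 * P 0 0 = 1 := by
      have := hP 0 0
      rw [abs_le] at this
      obtain h | h : P 0 0 = 1 ∨ P 0 0 = -1 := by omega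
      all_goals simp [h]
    have hpabs : |P 0 0| = 1 := by
      have := abs_mul_abs_self (P 0 0)
      rw [hpiv] at this
      nlinarith [abs_nonneg (P 0 0)]
    rw [← hdet, det_eq_mul_det_schur P hpiv, abs_mul, hpabs, one_mul]
    set S : Matrix (Fin k) (Fin k) ℤ := Matrix.of fun i j =>
      P i.succ j.succ - P 0 0 * P i.succ 0 * P 0 j.succ with hS
    have hSd : ∀ (m : ℕ) (f g : Fin m → Fin k),
        2 ∣ (S.submatrix f g).det ↔ 3 ∣ (S.submatrix f g).det := by
      intro m f g
      have key := det_eq_mul_det_schur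
        (P.submatrix (Fin.cons 0 (Fin.succ ∘ f) : Fin (m + 1) → Fin (k + 1))
          (Fin.cons 0 (Fin.succ ∘ g) : Fin (m + 1) → Fin (k + 1))) (by simpa using hpiv)
      have e : (S.submatrix f g).det = P 0 0 * (P.submatrix
          (Fin.cons 0 (Fin.succ ∘ f) : Fin (m + 1) → Fin (k + 1))
          (Fin.cons 0 (Fin.succ ∘ g) : Fin (m + 1) → Fin (k + 1))).det := by
        rw [key]
        simp only [submatrix_apply, Fin.cons_zero, Fin.cons_succ, Function.comp]
        rw [← mul_assoc, hpiv, one_mul]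
        rfl
      have hu : IsUnit (P 0 0) := IsUnit.of_mul_eq_one _ hpiv
      rw [e, hu.dvd_mul_left, hu.dvd_mul_left]
      exact hPd _ _ _
    refine ih S (fun i j => ?_) hSd
    have h1 := hSd 1 (fun _ => i) (fun _ => j)
    simp only [det_unique, submatrix_apply] at h1
    have ha := hP i.succ j.succ
    have hb : |P 0 0 * P i.succ 0 * P 0 j.succ| ≤ 1 := by
      rw [abs_mul, abs_mul, hpabs, one_mul]
      exact mul_le_one₀ (hP _ _) (abs_nonneg _) (hP _ _)
    have hSij : S i j = P i.succ j.succ - P 0 0 * P i.succ 0 * P 0 j.succ := rfl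
    rw [abs_le] at ha hb ⊢
    omega

theorem det_extend_by_single {κ E R : Type*} [Fintype κ] [DecidableEq κ] [CommRing R]
    (w : E → κ → R) (g₁ : κ → E) (hg₁ : ∀ i, w (g₁ i) = Pi.single i 1)
    (p : κ → Prop) [DecidablePred p] (g : {i // p i} → E) :
    (Matrix.of fun i j => w (if h : p j then g ⟨j, h⟩ else g₁ j) i).det =
      (Matrix.of fun i j : {i // p i} => w (g j) i).det := by
  rw [twoBlockTriangular_det' _ p]
  · have h1 : toSquareBlockProp (Matrix.of fun i j => w (if h : p j then g ⟨j, h⟩ else g₁ j) i)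
        (fun i => ¬ p i) = 1 := by
      ext i j
      simp only [toSquareBlockProp_def, of_apply, dif_neg j.2, hg₁, Pi.single_apply, one_apply,
        Subtype.ext_iff]
    rw [h1, det_one, mul_one]
    congr 1
    ext i j
    simp [toSquareBlockProp_def, j.2]
  · intro i hi j hj
    have : i ≠ j := fun h => hj (h ▸ hi)
    simp [hj, hg₁, this]

open Module

/-- The vectors `w e` represent the rank function `ρ` over `K`. -/
def IsRep (K : Type*) [Field K] {V : Type*} [AddCommGroup V] [Module K V]
    (ρ : Finset E → ℕ) (w : E → V) : Prop :=
  ∀ S : Finset E, ρ S = finrank K (Submodule.span K (w '' (S : Set E)))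

theorem Representable.exists_isRep {M : Matroid E} {K : Type} [Field K]
    (h : Representable M K) : ∃ (n : ℕ) (v : E → Fin n → K), IsRep K M.r v := by
  obtain ⟨n, A, hA⟩ := h
  refine ⟨n, fun e i => A i e, fun S => ?_⟩
  have : Set.range (A.submatrix id (fun x : S => (x : E))).col =
      (fun e i => A i e) '' (S : Set E) := by
    ext x
    constructor
    · rintro ⟨e, rfl⟩; exact ⟨e, e.2, rfl⟩
    · rintro ⟨e, he, rfl⟩; exact ⟨⟨e, he⟩, rfl⟩
  rw [hA, rank_eq_finrank_span_cols, this]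

namespace IsRep

section

variable {K V : Type*} [Field K] [AddCommGroup V] [Module K V] {ρ : Finset E → ℕ} {w : E → V}

theorem linearIndepOn_iff (hw : IsRep K ρ w) (S : Finset E) :
    LinearIndepOn K w (S : Set E) ↔ ρ S = S.card := by
  unfold LinearIndepOn
  rw [linearIndependent_iff_card_eq_finrank_span, hw, Set.finrank, eq_comm]
  have : Set.range (fun x : (S : Set E) => w x) = w '' (S : Set E) := by
    rw [Set.image_eq_range]
  rw [this]
  simp

theorem span_eq_top_iff [FiniteDimensional K V] (hw : IsRep K ρ w) (S : Finset E) :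
    Submodule.span K (w '' (S : Set E)) = ⊤ ↔ ρ S = finrank K V := by
  rw [hw]
  exact ⟨fun h => by rw [h, finrank_top], Submodule.eq_top_of_finrank_eq⟩

theorem exists_extension (hw : IsRep K ρ w) {C S : Finset E} (hCS : C ⊆ S)
    (hC : ρ C = C.card) :
    ∃ B : Finset E, C ⊆ B ∧ B ⊆ S ∧ ρ B = B.card ∧ ρ B = ρ S ∧
      ∀ e ∈ S, w e ∈ Submodule.span K (w '' (B : Set E)) := by
  classical
  obtain ⟨b, hbS, hCb, hsp, hb⟩ := exists_linearIndepOn_extension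
    ((hw.linearIndepOn_iff C).2 hC) (Finset.coe_subset.2 hCS)
  have hfin : b.Finite := S.finite_toSet.subset hbS
  obtain ⟨B, rfl⟩ := hfin.exists_finset_coe
  refine ⟨B, by exact_mod_cast hCb, by exact_mod_cast hbS, (hw.linearIndepOn_iff B).1 hb, ?_,
    fun e he => hsp ⟨e, he, rfl⟩⟩
  rw [hw, hw]
  rw [le_antisymm (Submodule.span_mono (Set.image_mono hbS)) (Submodule.span_le.2 hsp)]

theorem exists_standard (hw : IsRep K ρ w) {κ : Type*} [Fintype κ] [DecidableEq κ]
    (g₁ : κ → E) (hg₁ : ρ (Finset.univ.image g₁) = Fintype.card κ)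
    (hr : ρ Finset.univ = Fintype.card κ) :
    ∃ N : E → κ → K, (∀ i, N (g₁ i) = Pi.single i 1) ∧ IsRep K ρ N := by
  classical
  have hE : Finite (w '' (Finset.univ : Finset E)) := Set.Finite.image _ (Finset.finite_toSet _)
  set W := Submodule.span K (w '' ((Finset.univ : Finset E) : Set E)) with hW
  have hmem : ∀ e, w e ∈ W := fun e => Submodule.subset_span ⟨e, by simp, rfl⟩
  let v : E → W := fun e => ⟨w e, hmem e⟩
  have hspan : ∀ S : Set E, (Submodule.span K (v '' S)).map W.subtype =
      Submodule.span K (w '' S) := fun S => by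
    rw [Submodule.map_span, ← Set.image_comp]; rfl
  have hfd : FiniteDimensional K W := FiniteDimensional.span_of_finite K hE
  have hv : IsRep K ρ v := fun S => by
    rw [hw, ← hspan]
    exact LinearEquiv.finrank_eq
      (Submodule.equivMapOfInjective _ (Submodule.subtype_injective W) _).symm
  have hdim : finrank K W = Fintype.card κ := by rw [← hr, hw]
  have hrange : Set.range (v ∘ g₁) = v '' ((Finset.univ.image g₁ : Finset E) : Set E) := by
    simp [Set.range_comp]
  have hli : LinearIndependent K (v ∘ g₁) := by
    rw [linearIndependent_iff_card_eq_finrank_span, Set.finrank, hrange, ← hv, hg₁]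
  have htop : ⊤ ≤ Submodule.span K (Set.range (v ∘ g₁)) := by
    rw [hrange, (hv.span_eq_top_iff _).2 (by rw [hg₁, hdim])]
  let b : Basis κ K W := Basis.mk hli htop
  refine ⟨fun e => b.equivFun (v e), fun i => ?_, fun S => ?_⟩
  · have : v (g₁ i) = b i := by simp [b]
    simp [this, Finsupp.single_eq_pi_single]
  · have : (fun e => b.equivFun (v e)) '' (S : Set E) = b.equivFun.toLinearMap '' (v '' S) := by
      rw [← Set.image_comp]; rfl
    rw [this, ← Submodule.map_span, LinearEquiv.finrank_map_eq, hv]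

end

section

variable {K : Type*} [Field K] {ρ : Finset E → ℕ} {κ : Type*} [Fintype κ] [DecidableEq κ]
  {w : E → κ → K}

theorem det_ne_zero_iff (hw : IsRep K ρ w) (g : κ → E) :
    (Matrix.of fun i j => w (g j) i).det ≠ 0 ↔ ρ (Finset.univ.image g) = Fintype.card κ := by
  rw [← isUnit_iff_ne_zero, ← Matrix.isUnit_iff_isUnit_det,
    ← Matrix.linearIndependent_cols_iff_isUnit, hw, eq_comm,
    linearIndependent_iff_card_eq_finrank_span, Set.finrank]
  have : Set.range (Matrix.of fun i j => w (g j) i).col =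
      w '' ((Finset.univ.image g : Finset E) : Set E) := by
    ext x
    simp only [Set.mem_range, Finset.coe_image, Finset.coe_univ, Set.image_univ, Set.mem_image,
      exists_exists_eq_and]
    rfl
  rw [this]

theorem det_minor_ne_zero_iff (hw : IsRep K ρ w) (g₁ : κ → E)
    (hg₁ : ∀ i, w (g₁ i) = Pi.single i 1) {m : ℕ} (f : Fin m → κ) (g : Fin m → E)
    (hf : f.Injective) :
    (Matrix.of fun i j => w (g j) (f i)).det ≠ 0 ↔
      ρ (Finset.univ.image g ∪ (Finset.univ.filter (fun i => ¬ ∃ a, f a = i)).image g₁) =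
        Fintype.card κ := by
  classical
  let φ : Fin m ≃ {i // ∃ a, f a = i} := Equiv.ofInjective f hf
  have key := det_extend_by_single w g₁ hg₁ (fun i => ∃ a, f a = i) (fun i => g (φ.symm i))
  have e : (Matrix.of fun i j => w (g j) (f i)).det =
      (Matrix.of fun i j : {i // ∃ a, f a = i} => w (g (φ.symm j)) i).det := by
    rw [← det_submatrix_equiv_self φ]
    congr 1
    ext i j
    change w (g j) (f i) = w (g (φ.symm (φ j))) (φ i : κ)
    rw [φ.symm_apply_apply]
    rfl
  rw [e, ← key, hw.det_ne_zero_iff]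
  congr! 2
  ext x
  simp only [Finset.mem_image, Finset.mem_univ, true_and, Finset.mem_union, Finset.mem_filter]
  constructor
  · rintro ⟨i, rfl⟩
    by_cases h : ∃ a, f a = i
    · left; exact ⟨φ.symm ⟨i, h⟩, by rw [dif_pos h]⟩
    · right; exact ⟨i, h, by rw [dif_neg h]⟩
  · rintro (⟨j, rfl⟩ | ⟨i, hi, rfl⟩)
    · refine ⟨f j, ?_⟩
      rw [dif_pos ⟨j, rfl⟩]
      congr 1
      rw [Equiv.symm_apply_eq]
      rfl
    · exact ⟨i, by rw [dif_neg hi]⟩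

end

end IsRep

theorem IsRep.mono {K V : Type*} [Field K] [AddCommGroup V] [Module K V]
    {ρ : Finset E → ℕ} {w : E → V} (hw : IsRep K ρ w) {S T : Finset E} (h : S ⊆ T) :
    ρ S ≤ ρ T := by
  rw [hw, hw]
  have : FiniteDimensional K (Submodule.span K (w '' (T : Set E))) :=
    FiniteDimensional.span_of_finite K (T.finite_toSet.image w)
  exact Submodule.finrank_mono (Submodule.span_mono (Set.image_mono (Finset.coe_subset.2 h)))

theorem IsRep.empty {K V : Type*} [Field K] [AddCommGroup V] [Module K V]
    {ρ : Finset E → ℕ} {w : E → V} (hw : IsRep K ρ w) : ρ ∅ = 0 := by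
  rw [hw, Finset.coe_empty, Set.image_empty, Submodule.span_empty, finrank_bot]

theorem exists_enum {κ : Type*} [Fintype κ] (B : Finset E)
    (hB : B.card = Fintype.card κ) :
    ∃ g : κ → E, g.Injective ∧ Finset.univ.image g = B := by
  have : Fintype.card κ = Fintype.card B := by simp [hB]
  let φ := Fintype.equivOfCardEq this
  refine ⟨fun i => φ i, fun i j h => φ.injective (Subtype.ext h), ?_⟩
  ext x
  simp only [Finset.mem_image, Finset.mem_univ, true_and]
  exact ⟨fun ⟨i, hi⟩ => hi ▸ (φ i).2, fun hx => ⟨φ.symm ⟨x, hx⟩, by simp⟩⟩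

theorem IsRep.rank_le {K₁ K₂ : Type*} [Field K₁] [Field K₂] {κ : Type*} [Fintype κ]
    [DecidableEq κ] {ρ₁ ρ₂ : Finset E → ℕ} {w₁ : E → κ → K₁} {w₂ : E → κ → K₂}
    (h₁ : IsRep K₁ ρ₁ w₁) (h₂ : IsRep K₂ ρ₂ w₂) (hr : ρ₁ Finset.univ = Fintype.card κ)
    (hdet : ∀ g : κ → E, (Matrix.of fun i j => w₁ (g j) i).det ≠ 0 →
      (Matrix.of fun i j => w₂ (g j) i).det ≠ 0) (S : Finset E) : ρ₁ S ≤ ρ₂ S := by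
  obtain ⟨B, -, hBS, hB, hBr, -⟩ := h₁.exists_extension (Finset.empty_subset S)
    (by rw [h₁.empty]; simp)
  obtain ⟨B', hBB', -, hB', hBr', -⟩ := h₁.exists_extension (Finset.subset_univ B) hB
  obtain ⟨g, -, hg⟩ := exists_enum (κ := κ) B' (by rw [← hB', hBr', hr])
  have hd := hdet g ((h₁.det_ne_zero_iff g).2 (by rw [hg, hBr', hr]))
  rw [h₂.det_ne_zero_iff, hg, ← hr, ← hBr', hB', ← h₂.linearIndepOn_iff] at hd
  have hd' := (h₂.linearIndepOn_iff B).1 (hd.mono (Finset.coe_subset.2 hBB'))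
  rw [← hBr, hB, ← hd']
  exact h₂.mono hBS

theorem det_submatrix_eq_zero_of_not_injective {R κ : Type*} [CommRing R] {m : ℕ}
    {w : E → κ → R} {f : Fin m → κ} (hf : ¬ f.Injective) (g : Fin m → E) :
    (Matrix.of fun i j => w (g j) (f i)).det = 0 := by
  simp only [Function.Injective, not_forall] at hf
  obtain ⟨a, b, hab, hne⟩ := hf
  exact det_zero_of_row_eq hne (by ext j; simp [hab])

theorem ZMod.valMinAbs_three : ∀ x : ZMod 3, |x.valMinAbs| ≤ 1 ∧ (x.valMinAbs : ZMod 3) = x ∧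
    ((x.valMinAbs : ZMod 2) = if x = 0 then 0 else 1) ∧ (x = 1 → x.valMinAbs = 1) := by
  decide

theorem exists_integral_standard {M : Matroid E} (hM : Regular M) {r : ℕ}
    (hr : M.r Finset.univ = r) :
    ∃ (N : E → Fin r → ℤ) (g₁ : Fin r → E),
      (∀ i, N (g₁ i) = Pi.single i 1) ∧
      (∀ g : Fin r → E, |(Matrix.of fun i j => N (g j) i).det| ≤ 1) ∧
      (∀ g : Fin r → E, (Matrix.of fun i j => N (g j) i).det ≠ 0 ↔
        M.r (Finset.univ.image g) = r) := by
  have : Fact (Nat.Prime 3) := ⟨by norm_num⟩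
  obtain ⟨n₂, v₂, hv₂⟩ := (hM (ZMod 2)).exists_isRep
  obtain ⟨n₃, v₃, hv₃⟩ := (hM (ZMod 3)).exists_isRep
  obtain ⟨B, -, -, hB, hBr, -⟩ := hv₃.exists_extension (Finset.empty_subset Finset.univ)
    (by rw [hv₃.empty]; simp)
  obtain ⟨g₁, -, hg₁⟩ := exists_enum (κ := Fin r) B (by rw [← hB, hBr]; simp [hr])
  have hcard : M.r Finset.univ = Fintype.card (Fin r) := by simp [hr]
  have hgr : M.r (Finset.univ.image g₁) = Fintype.card (Fin r) := by rw [hg₁, hBr, hcard]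
  obtain ⟨N₂, hN₂, hR₂⟩ := hv₂.exists_standard g₁ hgr hcard
  obtain ⟨N₃, hN₃, hR₃⟩ := hv₃.exists_standard g₁ hgr hcard
  have hminor : ∀ (m : ℕ) (f : Fin m → Fin r) (g : Fin m → E),
      (Matrix.of fun i j => N₂ (g j) (f i)).det = 0 ↔
        (Matrix.of fun i j => N₃ (g j) (f i)).det = 0 := by
    intro m f g
    by_cases hf : f.Injective
    · rw [← not_iff_not, ← ne_eq, ← ne_eq, hR₂.det_minor_ne_zero_iff g₁ hN₂ f g hf,
        hR₃.det_minor_ne_zero_iff g₁ hN₃ f g hf]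
    · simp only [det_submatrix_eq_zero_of_not_injective hf]
  have hentry : ∀ e i, N₂ e i = 0 ↔ N₃ e i = 0 := fun e i => by
    simpa using hminor 1 (fun _ => i) (fun _ => e)
  have hZ3 := ZMod.valMinAbs_three
  have hZ2 : ∀ x : ZMod 2, x = if x = 0 then 0 else 1 := by decide
  let N : E → Fin r → ℤ := fun e i => (N₃ e i).valMinAbs
  have hc3 : ∀ e i, ((N e i : ℤ) : ZMod 3) = N₃ e i := fun e i => (hZ3 _).2.1
  have hc2 : ∀ e i, ((N e i : ℤ) : ZMod 2) = N₂ e i := fun e i => by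
    rw [(hZ3 _).2.2.1, hZ2 (N₂ e i)]
    simp only [hentry]
  have hdet3 : ∀ (m : ℕ) (f : Fin m → Fin r) (g : Fin m → E),
      (((Matrix.of fun i j => N (g j) (f i)).det : ℤ) : ZMod 3) =
        (Matrix.of fun i j => N₃ (g j) (f i)).det := fun m f g => by
    rw [Int.cast_det]
    congr 1
    ext i j
    simp [hc3]
  have hdet2 : ∀ (m : ℕ) (f : Fin m → Fin r) (g : Fin m → E),
      (((Matrix.of fun i j => N (g j) (f i)).det : ℤ) : ZMod 2) =
        (Matrix.of fun i j => N₂ (g j) (f i)).det := fun m f g => by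
    rw [Int.cast_det]
    congr 1
    ext i j
    simp [hc2]
  have habs : ∀ g : Fin r → E, |(Matrix.of fun i j => N (g j) i).det| ≤ 1 := fun g =>
    abs_det_le_one_of_two_dvd_iff_three_dvd r _ (fun i j => (hZ3 _).1) fun m f h => by
      have h2 := ZMod.intCast_zmod_eq_zero_iff_dvd
        ((Matrix.of fun i j => N (g j) i).submatrix f h).det 2
      have h3 := ZMod.intCast_zmod_eq_zero_iff_dvd
        ((Matrix.of fun i j => N (g j) i).submatrix f h).det 3
      have e2 := hdet2 m f (g ∘ h)
      have e3 := hdet3 m f (g ∘ h)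
      have e := hminor m f (g ∘ h)
      rw [← e2, ← e3] at e
      exact (h2.symm.trans e).trans h3
  refine ⟨N, g₁, fun i => ?_, habs, fun g => ?_⟩
  · ext j
    by_cases hij : j = i
    · subst hij
      simp only [N, Pi.single_eq_same]
      exact (hZ3 _).2.2.2 (by simp [hN₃])
    · simp [N, hN₃, hij]
  · have h3 := hdet3 r id g
    have := hR₃.det_ne_zero_iff g
    rw [Fintype.card_fin] at this
    rw [← this]
    have h3' : (((Matrix.of fun i j => N (g j) i).det : ℤ) : ZMod 3) =
      (Matrix.of fun i j => N₃ (g j) i).det := h3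
    rw [← h3', ne_eq, ne_eq, not_iff_not, ZMod.intCast_zmod_eq_zero_iff_dvd]
    have := abs_le.1 (habs g)
    omega

/-- Every maximal minor of the vector configuration `w` squares to `1` on the bases of `ρ`, and
vanishes otherwise. -/
def IsUnimodular {F κ : Type*} [Field F] [Fintype κ] [DecidableEq κ]
    (ρ : Finset E → ℕ) (w : E → κ → F) : Prop :=
  ∀ g : κ → E, (Matrix.of fun i j => w (g j) i).det ^ 2 =
    if ρ (Finset.univ.image g) = Fintype.card κ then 1 else 0

/-- A regular matroid has a unimodular representation over every field. -/
theorem exists_isUnimodular {M : Matroid E} (hM : Regular M) {r : ℕ} (hr : M.r Finset.univ = r)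
    (F : Type*) [Field F] :
    ∃ w : E → Fin r → F, IsRep F M.r w ∧ IsUnimodular M.r w := by
  obtain ⟨N, g₁, hN₁, hNabs, hNdet⟩ := exists_integral_standard hM hr
  obtain ⟨n₃, v₃, hv₃⟩ := (hM ℚ).exists_isRep
  let w : E → Fin r → F := fun e i => (N e i : F)
  have hcast : ∀ g : Fin r → E, (Matrix.of fun i j => w (g j) i).det =
      (((Matrix.of fun i j => N (g j) i).det : ℤ) : F) := fun g => by
    rw [Int.cast_det]
    rfl
  have hsq : IsUnimodular M.r w := fun g => by
    have h := hNdet g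
    have h1 := abs_le.1 (hNabs g)
    rw [hcast, Fintype.card_fin]
    generalize (Matrix.of fun i j => N (g j) i).det = d at h h1
    obtain rfl | rfl | rfl : d = -1 ∨ d = 0 ∨ d = 1 := by omega
    all_goals simp_all
  have hne : ∀ g : Fin r → E, (Matrix.of fun i j => w (g j) i).det ≠ 0 ↔
      M.r (Finset.univ.image g) = r := fun g => by
    have := hsq g
    rw [Fintype.card_fin] at this
    rw [← not_iff_not, not_not, ← sq_eq_zero_iff, this]
    simp
  have hgr : M.r (Finset.univ.image g₁) = r := by
    rw [← hNdet]
    have : (Matrix.of fun i j => N (g₁ j) i) = 1 := by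
      ext i j
      simp [hN₁, Pi.single_apply, one_apply]
    simp [this]
  obtain ⟨N₃, hN₃, hR₃⟩ := hv₃.exists_standard g₁ (κ := Fin r) (by simp [hgr]) (by simp [hr])
  have hw : IsRep F (fun S => finrank F (Submodule.span F (w '' (S : Set E)))) w := fun S => rfl
  have h3 : ∀ g : Fin r → E, (Matrix.of fun i j => N₃ (g j) i).det ≠ 0 ↔
      (Matrix.of fun i j => w (g j) i).det ≠ 0 := fun g => by
    rw [hR₃.det_ne_zero_iff, hne, Fintype.card_fin]
  have hle := hR₃.rank_le hw (by simp [hr]) (fun g => (h3 g).1)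
  refine ⟨w, fun S => le_antisymm (hle S) (hw.rank_le hR₃ ?_ (fun g => (h3 g).2) S), hsq⟩
  refine le_antisymm ?_ ?_
  · exact (Submodule.finrank_le _).trans (by simp)
  · rw [Fintype.card_fin]
    exact hr.symm.trans_le (hle _)

theorem det_sum_rank_one {ι R : Type*} [Fintype ι] [DecidableEq ι] [CommRing R]
    (u : E → ι → R) (α : E → R) :
    (Matrix.of fun i j => ∑ e, α e * u e i * u e j).det =
      ∑ h : ι → E, (∏ i, α (h i) * u (h i) i) * (Matrix.of fun i j => u (h i) j).det := by
  have h1 : (Matrix.of fun i j => ∑ e, α e * u e i * u e j) =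
      fun i => ∑ e, (α e * u e i) • u e := by
    ext i j
    simp [Finset.sum_apply]
  rw [h1]
  change detRowAlternating.toMultilinearMap _ = _
  rw [MultilinearMap.map_sum]
  refine Finset.sum_congr rfl fun h _ => ?_
  exact MultilinearMap.map_smul_univ _ (fun i => α (h i) * u (h i) i) (fun i => u (h i))

theorem sum_det_perm {ι R : Type*} [Fintype ι] [DecidableEq ι] [CommRing R]
    (u : E → ι → R) (α : E → R) (g : ι → E) :
    ∑ σ : Equiv.Perm ι, (∏ i, α (g (σ i)) * u (g (σ i)) i) *
        (Matrix.of fun i j => u (g (σ i)) j).det =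
      (∏ i, α (g i)) * (Matrix.of fun i j => u (g j) i).det ^ 2 := by
  have hT : (Matrix.of fun i j => u (g j) i).det = (Matrix.of fun i j => u (g i) j).det := by
    rw [← det_transpose]; rfl
  have hσ : ∀ σ : Equiv.Perm ι, (∏ i, α (g (σ i)) * u (g (σ i)) i) *
        (Matrix.of fun i j => u (g (σ i)) j).det =
      (∏ i, α (g i)) * (Matrix.of fun i j => u (g j) i).det *
        ((Equiv.Perm.sign σ : ℤ) * ∏ i, (Matrix.of fun i j => u (g i) j) (σ i) i) := fun σ => by
    have := det_permute σ (Matrix.of fun i j => u (g i) j)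
    rw [Finset.prod_mul_distrib, Equiv.prod_comp σ (fun i => α (g i)), hT,
      show (Matrix.of fun i j => u (g (σ i)) j).det = _ from this]
    simp only [of_apply]
    ring
  simp_rw [hσ]
  rw [← Finset.mul_sum, ← det_apply', ← hT]
  ring

/-- The Cauchy-Binet formula for `∑ e, α e • u e (u e)ᵀ`. -/
theorem det_sum_rank_one_eq_sum_powersetCard {ι R : Type*} [Fintype ι] [DecidableEq ι]
    [CommRing R] (u : E → ι → R) (α : E → R) (en : Finset E → ι → E)
    (hen : ∀ B : Finset E, B.card = Fintype.card ι →
      (en B).Injective ∧ Finset.univ.image (en B) = B) :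
    (Matrix.of fun i j => ∑ e, α e * u e i * u e j).det =
      ∑ B ∈ Finset.univ.powersetCard (Fintype.card ι),
        (∏ e ∈ B, α e) * (Matrix.of fun i j => u (en B j) i).det ^ 2 := by
  classical
  rw [det_sum_rank_one, ← Finset.sum_filter_of_ne (p := Function.Injective)]
  swap
  · intro h _ hne
    by_contra hinj
    simp only [Function.Injective, not_forall] at hinj
    obtain ⟨a, b, hab, hne'⟩ := hinj
    refine hne ?_
    rw [det_zero_of_row_eq hne' (by ext j; simp [hab]), mul_zero]
  rw [← Finset.sum_fiberwise_of_maps_to (g := fun h => Finset.univ.image h)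
    (t := Finset.univ.powersetCard (Fintype.card ι))]
  swap
  · intro h hh
    simp only [Finset.mem_filter, Finset.mem_univ, true_and] at hh
    simp [Finset.mem_powersetCard, Finset.card_image_of_injective _ hh]
  refine Finset.sum_congr rfl fun B hB => ?_
  obtain ⟨hinj, himg⟩ := hen B (Finset.mem_powersetCard.1 hB).2
  have hprod : ∏ e ∈ B, α e = ∏ i, α (en B i) := by
    conv_lhs => rw [← himg]
    rw [Finset.prod_image (fun _ _ _ _ h => hinj h)]
  rw [hprod, ← sum_det_perm]
  symm
  refine Finset.sum_bij (fun (σ : Equiv.Perm ι) _ => en B ∘ σ) ?_ ?_ ?_ ?_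
  · intro σ _
    simp only [Finset.mem_filter, Finset.mem_univ, true_and]
    refine ⟨hinj.comp σ.injective, ?_⟩
    conv_rhs => rw [← himg]
    ext x
    simp only [Finset.mem_image, Finset.mem_univ, true_and, Function.comp]
    exact ⟨fun ⟨i, hi⟩ => ⟨σ i, hi⟩, fun ⟨i, hi⟩ => ⟨σ.symm i, by simpa using hi⟩⟩
  · intro σ _ τ _ h
    ext i
    exact hinj (congrFun h i)
  · intro h hh
    simp only [Finset.mem_filter, Finset.mem_univ, true_and] at hh
    have hmem : ∀ i, ∃ j, en B j = h i := fun i => by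
      have : h i ∈ Finset.univ.image (en B) := by rw [himg, ← hh.2]; simp
      simpa using this
    choose σ hσ using hmem
    have hσi : σ.Injective := fun i j hij => hh.1 (by rw [← hσ, ← hσ, hij])
    refine ⟨Equiv.ofBijective σ (Finite.injective_iff_bijective.1 hσi), by simp, ?_⟩
    ext i
    exact hσ i
  · intro σ _
    rfl

theorem IsRep.rank_union_eq {K V : Type*} [Field K] [AddCommGroup V] [Module K V]
    {ρ : Finset E → ℕ} {w : E → V} (hw : IsRep K ρ w) {C D : Finset E} (hCD : C ⊆ D)
    (h : ∀ e ∈ D, w e ∈ Submodule.span K (w '' (C : Set E))) (B : Finset E) :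
    ρ (B ∪ C) = ρ (B ∪ D) := by
  rw [hw, hw]
  have : Submodule.span K (w '' ((B ∪ C : Finset E) : Set E)) =
      Submodule.span K (w '' ((B ∪ D : Finset E) : Set E)) := by
    simp only [Finset.coe_union, Set.image_union, Submodule.span_union]
    congr 1
    refine le_antisymm (Submodule.span_mono (Set.image_mono (Finset.coe_subset.2 hCD))) ?_
    rw [Submodule.span_le]
    rintro _ ⟨e, he, rfl⟩
    exact h e he
  rw [this]

theorem rank_compl_add_card {F κ : Type*} [Field F] [Fintype κ] [DecidableEq κ]
    {ρ : Finset E → ℕ} {w : E → κ → F} (hw : IsRep F ρ w)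
    (g₁ : κ → E) (hg₁ : ∀ i, w (g₁ i) = Pi.single i 1) (A : Finset E)
    (hA : ∀ e ∉ A, ∀ i, g₁ i ∈ A → w e i = 0) :
    ρ Aᶜ + Fintype.card {i // g₁ i ∈ A} = Fintype.card κ ∧
      ∀ B, ρ (B ∪ (Finset.univ.filter fun i => g₁ i ∉ A).image g₁) = ρ (B ∪ Aᶜ) := by
  have hinj : g₁.Injective := fun i j h => by
    have h' : (Pi.single i 1 : κ → F) = Pi.single j 1 := by rw [← hg₁, ← hg₁, h]
    by_contra hne
    have := congrFun h' i
    simp [hne] at this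
  set C := (Finset.univ.filter fun i => g₁ i ∉ A).image g₁ with hC
  have hsub : C ⊆ Aᶜ := by
    intro e he
    obtain ⟨i, hi, rfl⟩ := Finset.mem_image.1 he
    simpa using hi
  have hmem : ∀ e ∈ Aᶜ, w e ∈ Submodule.span F (w '' (C : Set E)) := fun e he => by
    rw [Finset.mem_compl] at he
    rw [pi_eq_sum_univ' (w e)]
    refine Submodule.sum_mem _ fun i _ => ?_
    by_cases hi : g₁ i ∈ A
    · rw [hA e he i hi, zero_smul]
      exact Submodule.zero_mem _
    · refine Submodule.smul_mem _ _ (Submodule.subset_span ⟨g₁ i, ?_, ?_⟩)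
      · exact Finset.mem_coe.2 (Finset.mem_image_of_mem _ (by simpa using hi))
      · rw [hg₁]
  have hu := hw.rank_union_eq hsub hmem
  refine ⟨?_, hu⟩
  have h1 : ρ C = C.card := by
    rw [← hw.linearIndepOn_iff]
    have hli : LinearIndepOn F w (Set.range g₁) := by
      rw [linearIndepOn_range_iff hinj]
      have : w ∘ g₁ = Pi.basisFun F κ := by
        ext i : 1
        simp [hg₁]
      rw [this]
      exact (Pi.basisFun F κ).linearIndependent
    refine hli.mono ?_
    simp only [hC, Finset.coe_image]
    exact Set.image_subset_range _ _
  have h2 := hu ∅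
  rw [Finset.empty_union, Finset.empty_union] at h2
  rw [← h2, h1, hC, Finset.card_image_of_injective _ hinj, Fintype.card_subtype, add_comm,
    Finset.card_filter_add_card_filter_not]
  rfl

/-- The basis polynomial of the contraction onto `A` as a principal minor of `∑ e, α e • w e (w e)ᵀ`,
for a representation adapted to `A`. -/
theorem sContr_eq_det {F κ : Type*} [Field F] [Fintype κ] [DecidableEq κ]
    {M : Matroid E} {w : E → κ → F} (hw : IsRep F M.r w) (hU : IsUnimodular M.r w)
    (hr : M.r Finset.univ = Fintype.card κ)
    (g₁ : κ → E) (hg₁ : ∀ i, w (g₁ i) = Pi.single i 1) (A : Finset E)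
    (hA : ∀ e ∉ A, ∀ i, g₁ i ∈ A → w e i = 0) (α : E → F) :
    ∑ B ∈ contrBases M A, ∏ e ∈ B, α e =
      (Matrix.of fun i j : {i // g₁ i ∈ A} => ∑ e, α e * w e i * w e j).det := by
  classical
  obtain ⟨hcard, hu⟩ := rank_compl_add_card hw g₁ hg₁ A hA
  have hen : ∀ B : Finset E, ∃ g : {i // g₁ i ∈ A} → E,
      B.card = Fintype.card {i // g₁ i ∈ A} → g.Injective ∧ Finset.univ.image g = B := by
    intro B
    by_cases h : B.card = Fintype.card {i // g₁ i ∈ A}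
    · obtain ⟨g, hg⟩ := exists_enum (κ := {i // g₁ i ∈ A}) B h
      exact ⟨g, fun _ => hg⟩
    · exact ⟨fun i => g₁ i, fun h' => absurd h' h⟩
  choose en hen using hen
  rw [det_sum_rank_one_eq_sum_powersetCard (fun e (i : {i // g₁ i ∈ A}) => w e i) α en hen]
  have hsub : contrBases M A ⊆ Finset.univ.powersetCard (Fintype.card {i // g₁ i ∈ A}) := by
    intro B hB
    simp only [contrBases, Finset.mem_filter, Finset.mem_powerset] at hB
    rw [Finset.mem_powersetCard]
    refine ⟨Finset.subset_univ _, ?_⟩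
    omega
  have hdet : ∀ B : Finset E, B.card = Fintype.card {i // g₁ i ∈ A} →
      (Matrix.of fun i j : {i // g₁ i ∈ A} => w (en B j) i).det ^ 2 =
        if M.r (B ∪ Aᶜ) = Fintype.card κ then 1 else 0 := by
    intro B hB
    rw [← det_extend_by_single w g₁ hg₁ (fun i => g₁ i ∈ A) (en B), hU, ← hu B]
    congr! 3
    conv_rhs => rw [← (hen B hB).2]
    ext x
    simp only [Finset.mem_image, Finset.mem_univ, true_and, Finset.mem_union, Finset.mem_filter,
      Subtype.exists]
    constructor
    · rintro ⟨i, rfl⟩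
      by_cases h : g₁ i ∈ A
      · left; exact ⟨i, h, by rw [dif_pos h]⟩
      · right; exact ⟨i, h, by rw [dif_neg h]⟩
    · rintro (⟨i, hi, rfl⟩ | ⟨i, hi, rfl⟩)
      · exact ⟨i, by rw [dif_pos hi]⟩
      · exact ⟨i, by rw [dif_neg hi]⟩
  refine Finset.sum_subset_zero_on_sdiff hsub (fun B hB => ?_) (fun B hB => ?_)
  · rw [Finset.mem_sdiff, Finset.mem_powersetCard] at hB
    obtain ⟨⟨-, hBc⟩, hBn⟩ := hB
    by_cases hBA : B ⊆ A
    · rw [hdet B hBc, if_neg, mul_zero]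
      intro h
      refine hBn ?_
      simp only [contrBases, Finset.mem_filter, Finset.mem_powerset]
      refine ⟨hBA, ?_, ?_⟩ <;> omega
    · obtain ⟨e, heB, heA⟩ := Finset.not_subset.1 hBA
      rw [← (hen B hBc).2] at heB
      obtain ⟨j, -, rfl⟩ := Finset.mem_image.1 heB
      rw [det_eq_zero_of_column_eq_zero j fun i => hA _ heA i i.2]
      simp
  · have hBc := (Finset.mem_powersetCard.1 (hsub hB)).2
    simp only [contrBases, Finset.mem_filter, Finset.mem_powerset] at hB
    rw [hdet B hBc, if_pos (hB.2.2.trans hr), mul_one]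

theorem addChar_map_sum {A R ι : Type*} [AddCommMonoid A] [CommMonoid R] (ψ : AddChar A R)
    (s : Finset ι) (f : ι → A) : ψ (∑ i ∈ s, f i) = ∏ i ∈ s, ψ (f i) := by
  classical
  induction s using Finset.induction_on with
  | empty => simp
  | insert a s ha ih => rw [Finset.sum_insert ha, Finset.prod_insert ha, AddChar.map_add_eq_mul, ih]

theorem sum_addChar_mul_sq {F R : Type*} [Field F] [Fintype F] [DecidableEq F] [Field R]
    (hF : ringChar F ≠ 2) {ψ : AddChar F R} (hψ : ψ.IsPrimitive) {a : F} (ha : a ≠ 0) :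
    ∑ t, ψ (a * t ^ 2) = ((quadraticChar F a : ℤ) : R) *
      gaussSum ((quadraticChar F).ringHomComp (Int.castRingHom R)) ψ := by
  set χ := (quadraticChar F).ringHomComp (Int.castRingHom R) with hχ
  have hχa : ∀ b, χ b = ((quadraticChar F b : ℤ) : R) := fun b => rfl
  have h1 : ∑ t, ψ (a * t ^ 2) = ∑ b, (χ b + 1) * ψ (a * b) := by
    rw [← Finset.sum_fiberwise _ (fun t : F => t ^ 2)]
    refine Finset.sum_congr rfl fun b _ => ?_
    rw [Finset.sum_congr rfl (g := fun _ => ψ (a * b)) fun t ht => by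
      rw [(Finset.mem_filter.1 ht).2], Finset.sum_const, nsmul_eq_mul]
    congr 1
    have := congrArg (Int.cast (R := R)) (quadraticChar_card_sqrts hF b)
    push_cast at this
    rw [hχa, ← this]
    congr 2
    ext t
    simp
  have h2 : ∑ b, ψ (a * b) = 0 := by
    simpa [ha, mul_comm] using AddChar.sum_mulShift a hψ
  have h3 := gaussSum_mulShift χ ψ (Units.mk0 a ha)
  simp only [Units.val_mk0] at h3
  have h4 : χ a * χ a = 1 := by
    rw [hχa, ← Int.cast_mul, ← sq, quadraticChar_sq_one ha, Int.cast_one]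
  simp_rw [h1, add_mul, one_mul, Finset.sum_add_distrib, h2, add_zero]
  rw [← hχa, ← h3, ← mul_assoc, h4, one_mul]
  simp [gaussSum]

/-- A symmetric matrix is congruent to a diagonal one away from characteristic two. -/
theorem exists_transpose_mul_mul_eq_diagonal {K J : Type*} [Field K] [Fintype J]
    [DecidableEq J] (h2 : (2 : K) ≠ 0) {S : Matrix J J K} (hS : S.IsSymm) :
    ∃ (P : Matrix J J K) (d : J → K), P.det ≠ 0 ∧ Pᵀ * S * P = diagonal d := by
  have : Invertible (2 : K) := invertibleOfNonzero h2
  have hB : LinearMap.IsSymm (Matrix.toBilin' S) := ⟨fun x y => by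
    rw [RingHom.id_apply, Matrix.toBilin'_apply', Matrix.toBilin'_apply', dotProduct_mulVec,
      ← mulVec_transpose, hS.eq, dotProduct_comm]⟩
  obtain ⟨v, hv⟩ := LinearMap.BilinForm.exists_orthogonal_basis hB
  let e : Fin (finrank K (J → K)) ≃ J := Fintype.equivOfCardEq (by simp)
  let b := v.reindex e
  refine ⟨of fun i j => b j i, fun i => Matrix.toBilin' S (b i) (b i), ?_, ?_⟩
  · have h := (Pi.basisFun K J).isUnit_det b
    rw [Module.Basis.det_apply] at h
    exact h.ne_zero
  · ext i j
    have hij : ((of fun i j => b j i)ᵀ * S * of fun i j => b j i) i j =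
        Matrix.toBilin' S (b i) (b j) := by
      rw [Matrix.toBilin'_apply', Matrix.mul_assoc, Matrix.mul_apply']
      rfl
    rw [hij, diagonal_apply]
    split_ifs with h
    · rw [h]
    · have := hv (e.symm.injective.ne h)
      simpa [b, Function.onFun] using this

theorem sum_addChar_quadratic_of_det_ne_zero {F R J : Type*} [Field F] [Fintype F]
    [DecidableEq F] [Field R] [Fintype J] [DecidableEq J]
    (hF : ringChar F ≠ 2) {ψ : AddChar F R} (hψ : ψ.IsPrimitive)
    {S : Matrix J J F} (hS : S.IsSymm) (hdet : S.det ≠ 0) :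
    ∑ y : J → F, ψ (y ⬝ᵥ S *ᵥ y) = ((quadraticChar F S.det : ℤ) : R) *
      gaussSum ((quadraticChar F).ringHomComp (Int.castRingHom R)) ψ ^ Fintype.card J := by
  obtain ⟨P, d, hP, hd⟩ := exists_transpose_mul_mul_eq_diagonal
    (Ring.two_ne_zero hF) hS
  have hdetd : P.det ^ 2 * S.det = ∏ i, d i := by
    rw [← det_diagonal, ← hd, det_mul, det_mul, det_transpose]; ring
  have hprod : ∏ i, d i ≠ 0 := by
    rw [← hdetd]; exact mul_ne_zero (pow_ne_zero _ hP) hdet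
  have hη : quadraticChar F S.det = ∏ i, quadraticChar F (d i) := by
    rw [← map_prod, ← hdetd, map_mul, quadraticChar_sq_one' hP, one_mul]
  have hbij : Function.Bijective fun y : J → F => P *ᵥ y :=
    (Finite.injective_iff_bijective).1
      (Matrix.mulVec_injective_of_isUnit ((P.isUnit_iff_isUnit_det).2 hP.isUnit))
  rw [← hbij.sum_comp]
  have hq : ∀ y : J → F, P *ᵥ y ⬝ᵥ S *ᵥ (P *ᵥ y) = ∑ i, d i * y i ^ 2 := fun y => by
    have : P *ᵥ y ⬝ᵥ S *ᵥ (P *ᵥ y) = y ⬝ᵥ (Pᵀ * S * P) *ᵥ y := by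
      rw [Matrix.mul_assoc, ← mulVec_mulVec, dotProduct_mulVec y, vecMul_transpose,
        mulVec_mulVec]
    rw [this, hd]
    simp only [dotProduct, mulVec_diagonal]
    exact Finset.sum_congr rfl fun i _ => by ring
  simp_rw [hq, addChar_map_sum]
  rw [← Fintype.prod_sum (fun i t => ψ (d i * t ^ 2))]
  rw [Finset.prod_congr rfl fun i _ => sum_addChar_mul_sq hF hψ
    (Finset.prod_ne_zero_iff.1 hprod i (Finset.mem_univ i)), Finset.prod_mul_distrib,
    Finset.prod_const, hη, Int.cast_prod, Finset.card_univ]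

theorem eq_zero_of_det_submatrix_eq_zero {K J : Type*} [Field K] {N : Matrix J J K}
    (hN : N.IsSymm)
    (h : ∀ (m : ℕ) (f : Fin m → J), 0 < m → f.Injective → (N.submatrix f f).det = 0) :
    N = 0 := by
  have hdiag : ∀ c, N c c = 0 := fun c => by
    have := h 1 ![c] one_pos (Function.injective_of_subsingleton _)
    rwa [det_fin_one] at this
  ext c d
  by_cases hcd : c = d
  · rw [hcd, hdiag, Matrix.zero_apply]
  · have := h 2 ![c, d] two_pos (by
      intro i j
      fin_cases i <;> fin_cases j <;> simp [hcd, Ne.symm hcd])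
    rw [det_fin_two] at this
    simp only [submatrix_apply, cons_val_zero, cons_val_one, hdiag, zero_mul, zero_sub,
      neg_eq_zero, hN.apply c d] at this
    simpa using this

theorem sum_quadratic_fromBlocks {F R ι₁ ι₂ : Type*} [Field F] [Fintype F] [Field R]
    [Fintype ι₁] [DecidableEq ι₁] [Fintype ι₂] [DecidableEq ι₂] (φ : F → R)
    {N : Matrix (ι₁ ⊕ ι₂) (ι₁ ⊕ ι₂) F} (hN : N.IsSymm) (hdet : N.toBlocks₁₁.det ≠ 0)
    (h : ∀ (m : ℕ) (f : Fin m → ι₂), 0 < m → f.Injective →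
      (N.submatrix (Sum.map id f) (Sum.map id f)).det = 0) :
    ∑ x : ι₁ ⊕ ι₂ → F, φ (x ⬝ᵥ N *ᵥ x) =
      (Fintype.card F : R) ^ Fintype.card ι₂ *
        ∑ y : ι₁ → F, φ (y ⬝ᵥ N.toBlocks₁₁ *ᵥ y) := by
  classical
  set X := N.toBlocks₁₁ with hX
  set Y := N.toBlocks₁₂ with hY
  set Z := N.toBlocks₂₂ with hZ
  have hXs : Xᵀ = X := by ext i j; exact hN.apply _ _
  have hZs : Zᵀ = Z := by ext i j; exact hN.apply _ _
  have hNb : N = fromBlocks X Y Yᵀ Z := by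
    conv_lhs => rw [← fromBlocks_toBlocks N]
    congr 1
    ext i j
    exact hN.apply _ _
  have hu : IsUnit X.det := hdet.isUnit
  let _ : Invertible X := X.invertibleOfIsUnitDet hu
  have hZY : Z - Yᵀ * X⁻¹ * Y = 0 := by
    refine eq_zero_of_det_submatrix_eq_zero ?_ fun m f hm hf => ?_
    · rw [IsSymm, transpose_sub, hZs, transpose_mul, transpose_mul, transpose_transpose,
        transpose_nonsing_inv, hXs, Matrix.mul_assoc]
    · have h1 := h m f hm hf
      have h2 : N.submatrix (Sum.map id f) (Sum.map id f) =
          fromBlocks X (Y.submatrix id f) (Yᵀ.submatrix f id) (Z.submatrix f f) := by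
        rw [hNb]
        ext (i | i) (j | j) <;> rfl
      rw [h2, det_fromBlocks₁₁, invOf_eq_nonsing_inv] at h1
      exact (mul_eq_zero.1 h1).resolve_left hdet
  have hquad : ∀ (y : ι₁ → F) (z : ι₂ → F), Sum.elim y z ⬝ᵥ N *ᵥ Sum.elim y z =
      (y + X⁻¹ *ᵥ Y *ᵥ z) ⬝ᵥ X *ᵥ (y + X⁻¹ *ᵥ Y *ᵥ z) := fun y z => by
    have hZ' : Z = Yᵀ * X⁻¹ * Y := sub_eq_zero.1 hZY
    rw [hNb, fromBlocks_mulVec]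
    simp only [Sum.elim_comp_inl, Sum.elim_comp_inr, sumElim_dotProduct_sumElim]
    have e1 : X *ᵥ X⁻¹ *ᵥ Y *ᵥ z = Y *ᵥ z := by
      rw [mulVec_mulVec, mul_nonsing_inv _ hu, one_mulVec]
    have e2 : ∀ v : ι₁ → F, X⁻¹ *ᵥ Y *ᵥ z ⬝ᵥ v = z ⬝ᵥ Yᵀ *ᵥ X⁻¹ *ᵥ v := fun v => by
      rw [dotProduct_comm, dotProduct_mulVec, dotProduct_mulVec, ← mulVec_transpose,
        ← mulVec_transpose, transpose_nonsing_inv, hXs, dotProduct_comm]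
    rw [mulVec_add, e1, add_dotProduct, e2, mulVec_add X⁻¹, mulVec_mulVec (M := X⁻¹) (N := X),
      nonsing_inv_mul _ hu, one_mulVec, hZ', dotProduct_add z, dotProduct_add y,
      mulVec_add, dotProduct_add z]
    simp only [mulVec_mulVec, Matrix.mul_assoc]
  rw [← (Equiv.sumArrowEquivProdArrow ι₁ ι₂ F).symm.sum_comp, Fintype.sum_prod_type_right]
  have hz : ∀ z : ι₂ → F, ∑ y : ι₁ → F, φ (Sum.elim y z ⬝ᵥ N *ᵥ Sum.elim y z) =
      ∑ y : ι₁ → F, φ (y ⬝ᵥ X *ᵥ y) := fun z => by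
    simp_rw [hquad]
    exact Equiv.sum_comp (Equiv.addRight (X⁻¹ *ᵥ Y *ᵥ z)) fun y => φ (y ⬝ᵥ X *ᵥ y)
  refine (Finset.sum_congr rfl fun z _ => hz z).trans ?_
  rw [Finset.sum_const, Finset.card_univ, Fintype.card_fun, nsmul_eq_mul, Nat.cast_pow]

/-- A quadratic character sum whose matrix has a nonvanishing principal minor such that all
strictly larger principal minors containing it vanish. -/
theorem sum_addChar_quadratic {F R κ : Type*} [Field F] [Fintype F] [DecidableEq F] [Field R]
    [Fintype κ] [DecidableEq κ] (hF : ringChar F ≠ 2) {ψ : AddChar F R} (hψ : ψ.IsPrimitive)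
    {K : Matrix κ κ F} (hK : K.IsSymm) (P : κ → Prop) [DecidablePred P]
    (hdet : (K.submatrix (Subtype.val : {i // P i} → κ) Subtype.val).det ≠ 0)
    (h : ∀ Q : κ → Prop, ∀ _ : DecidablePred Q, (∀ i, P i → Q i) → (∃ i, Q i ∧ ¬ P i) →
      (K.submatrix (Subtype.val : {i // Q i} → κ) Subtype.val).det = 0) :
    ∑ x : κ → F, ψ (x ⬝ᵥ K *ᵥ x) =
      (Fintype.card F : R) ^ Fintype.card {i // ¬ P i} *
        (((quadraticChar F (K.submatrix (Subtype.val : {i // P i} → κ) Subtype.val).det : ℤ) : R) *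
          gaussSum ((quadraticChar F).ringHomComp (Int.castRingHom R)) ψ ^
            Fintype.card {i // P i}) := by
  classical
  let e := Equiv.sumCompl P
  have h1 : ∑ x : κ → F, ψ (x ⬝ᵥ K *ᵥ x) =
      ∑ x : {i // P i} ⊕ {i // ¬ P i} → F, ψ (x ⬝ᵥ K.submatrix e e *ᵥ x) := by
    rw [← (Equiv.arrowCongr e (Equiv.refl F)).sum_comp]
    refine Finset.sum_congr rfl fun x _ => ?_
    congr 1
    have : (Equiv.arrowCongr e (Equiv.refl F)) x = x ∘ e.symm := rfl
    rw [this, submatrix_mulVec_equiv, ← comp_equiv_symm_dotProduct]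
  have hX : (K.submatrix e e).toBlocks₁₁ =
      K.submatrix (Subtype.val : {i // P i} → κ) Subtype.val := rfl
  rw [h1, sum_quadratic_fromBlocks ψ (hK.submatrix e) (hX ▸ hdet), hX,
    sum_addChar_quadratic_of_det_ne_zero hF hψ (hK.submatrix _) hdet]
  intro m f hm hf
  let t : {i // P i} ⊕ Fin m → κ := Sum.elim Subtype.val (Subtype.val ∘ f)
  have ht : t.Injective := by
    rintro (i | i) (j | j) hij
    · exact congrArg Sum.inl (Subtype.ext hij)
    · exact absurd ((show (i : κ) = f j from hij) ▸ i.2) (f j).2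
    · exact absurd ((show (f i : κ) = j from hij) ▸ j.2) (f i).2
    · exact congrArg Sum.inr (hf (Subtype.ext hij))
  have h2 := h (fun i => i ∈ Set.range t) inferInstance
    (fun i hi => ⟨Sum.inl ⟨i, hi⟩, rfl⟩) ⟨f ⟨0, hm⟩, ⟨Sum.inr ⟨0, hm⟩, rfl⟩, (f _).2⟩
  have h3 := det_submatrix_equiv_self (Equiv.ofInjective t ht)
    (K.submatrix (Subtype.val : Set.range t → κ) Subtype.val)
  have h4 : (K.submatrix (Subtype.val : Set.range t → κ) Subtype.val).det = 0 := by
    convert h2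
  rw [h4] at h3
  rw [← h3]
  congr 1
  ext (i | i) (j | j) <;> rfl

theorem exists_adapted {F κ : Type*} [Field F] [Fintype κ] [DecidableEq κ]
    {ρ : Finset E → ℕ} {w : E → κ → F} (hw : IsRep F ρ w) (hU : IsUnimodular ρ w)
    (hr : ρ Finset.univ = Fintype.card κ) (A : Finset E) :
    ∃ (w' : E → κ → F) (G : Matrix κ κ F) (g₁ : κ → E), IsUnit G ∧ (∀ e, w' e = G *ᵥ w e) ∧
      IsRep F ρ w' ∧ IsUnimodular ρ w' ∧ (∀ i, w' (g₁ i) = Pi.single i 1) ∧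
      ∀ e ∉ A, ∀ i, g₁ i ∈ A → w' e i = 0 := by
  obtain ⟨C, -, hCA, hC, -, hspan⟩ := hw.exists_extension (Finset.empty_subset Aᶜ)
    (by rw [hw.empty]; simp)
  obtain ⟨B, hCB, -, hB, hBr, -⟩ := hw.exists_extension (Finset.subset_univ C) hC
  obtain ⟨g₁, -, hg₁⟩ := exists_enum (κ := κ) B (by rw [← hB, hBr, hr])
  let G₀ : Matrix κ κ F := Matrix.of fun i j => w (g₁ j) i
  have hdet : IsUnit G₀.det := ((hw.det_ne_zero_iff g₁).2 (by rw [hg₁, hBr, hr])).isUnit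
  have hdet2 : G₀.det ^ 2 = 1 := by
    rw [hU g₁, hg₁, hBr, hr, if_pos rfl]
  have hu : IsUnit G₀⁻¹ := by
    rw [isUnit_iff_isUnit_det, det_nonsing_inv]
    simpa using hdet
  have hsingle : ∀ i, G₀⁻¹ *ᵥ w (g₁ i) = Pi.single i 1 := fun i => by
    have : w (g₁ i) = G₀ *ᵥ Pi.single i 1 := by
      ext j
      simp [G₀]
    rw [this, mulVec_mulVec, nonsing_inv_mul _ hdet, one_mulVec]
  let L : (κ → F) ≃ₗ[F] (κ → F) := LinearEquiv.ofInjectiveEndo G₀⁻¹.mulVecLin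
    (mulVec_injective_of_isUnit hu)
  refine ⟨fun e => G₀⁻¹ *ᵥ w e, G₀⁻¹, g₁, hu, fun _ => rfl, fun S => ?_, fun g => ?_, hsingle, ?_⟩
  · have : (fun e => G₀⁻¹ *ᵥ w e) '' (S : Set E) = L.toLinearMap '' (w '' (S : Set E)) := by
      rw [← Set.image_comp]; rfl
    rw [this, ← Submodule.map_span, LinearEquiv.finrank_map_eq, hw]
  · have : (Matrix.of fun i j => (G₀⁻¹ *ᵥ w (g j)) i) =
        G₀⁻¹ * Matrix.of fun i j => w (g j) i := by
      ext i j
      rfl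
    rw [this, det_mul, mul_pow, hU g, det_nonsing_inv, Ring.inverse_eq_inv', inv_pow, hdet2,
      inv_one, one_mul]
  · intro e he i hi
    have hle : Submodule.span F (w '' (C : Set E)) ≤
        LinearMap.ker (LinearMap.proj i ∘ₗ G₀⁻¹.mulVecLin) := by
      rw [Submodule.span_le]
      rintro _ ⟨c, hc, rfl⟩
      obtain ⟨j, -, rfl⟩ := Finset.mem_image.1 (hg₁ ▸ hCB hc)
      have hij : i ≠ j := by
        rintro rfl
        exact Finset.mem_compl.1 (hCA hc) hi
      simp [hsingle, hij]
    exact hle (hspan e (Finset.mem_compl.2 he))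

theorem dotProduct_sum_rank_one {F κ : Type*} [CommRing F] [Fintype κ]
    (w : E → κ → F) (α : E → F) (x : κ → F) :
    x ⬝ᵥ (Matrix.of fun i j => ∑ e, α e * w e i * w e j) *ᵥ x =
      ∑ e, α e * (x ⬝ᵥ w e) ^ 2 := by
  simp only [dotProduct, mulVec, of_apply, sq, Finset.mul_sum,
    Finset.sum_mul]
  rw [Finset.sum_comm (s := Finset.univ (α := E))]
  refine Finset.sum_congr rfl fun i _ => ?_
  rw [Finset.sum_comm (s := Finset.univ (α := E))]
  exact Finset.sum_congr rfl fun j _ => Finset.sum_congr rfl fun e _ => by ring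

theorem det_submatrix_val_congr {R κ : Type*} [CommRing R] [Fintype κ] [DecidableEq κ]
    (K : Matrix κ κ R) {P Q : κ → Prop} [DecidablePred P] [DecidablePred Q]
    (h : ∀ i, P i ↔ Q i) :
    (K.submatrix (Subtype.val : {i // P i} → κ) Subtype.val).det =
      (K.submatrix (Subtype.val : {i // Q i} → κ) Subtype.val).det := by
  rw [← det_submatrix_equiv_self (Equiv.subtypeEquivRight h)]
  rfl

theorem sum_addChar_eq_gaussSum {F : Type} {R κ : Type*} [Field F] [Fintype F]
    [DecidableEq F] [Field R] [Fintype κ] [DecidableEq κ] (hF : ringChar F ≠ 2) {ψ : AddChar F R} (hψ : ψ.IsPrimitive)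
    {M : Matroid E} {w : E → κ → F} (hw : IsRep F M.r w) (hU : IsUnimodular M.r w)
    (hr : M.r Finset.univ = Fintype.card κ) (α : E → F) (A : Finset E)
    (hA : sContr M A α ≠ 0) (hmax : ∀ A', sContr M A' α ≠ 0 → A'.card ≤ A.card) :
    ∑ x : κ → F, ψ (∑ e, α e * (x ⬝ᵥ w e) ^ 2) =
      (Fintype.card F : R) ^ M.r Aᶜ * (((quadraticChar F (sContr M A α) : ℤ) : R) *
        gaussSum ((quadraticChar F).ringHomComp (Int.castRingHom R)) ψ ^
          (M.r Finset.univ - M.r Aᶜ)) := by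
  obtain ⟨v, G, g₁, hG, hv, hrep, huni, hg₁, hvA⟩ := exists_adapted hw hU hr A
  have hinj : g₁.Injective := fun i j h => by
    have h' : (Pi.single i 1 : κ → F) = Pi.single j 1 := by rw [← hg₁, ← hg₁, h]
    by_contra hne
    simpa [hne] using congrFun h' i
  set K : Matrix κ κ F := Matrix.of fun i j => ∑ e, α e * v e i * v e j with hK
  have hdet : ∀ D : Finset E, (∀ e ∉ D, ∀ i, g₁ i ∈ D → v e i = 0) →
      sContr M D α = (K.submatrix (Subtype.val : {i // g₁ i ∈ D} → κ) Subtype.val).det :=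
    fun D hD => sContr_eq_det hrep huni hr g₁ hg₁ D hD α
  have hsub : ∀ D : Finset E, (∀ e ∉ D, e ∈ Set.range g₁) →
      ∀ e ∉ D, ∀ i, g₁ i ∈ D → v e i = 0 := by
    intro D hD e he i hi
    obtain ⟨j, rfl⟩ := hD e he
    have hij : i ≠ j := by
      rintro rfl
      exact he hi
    simp [hg₁, hij]
  have hrange : ∀ e ∉ A, e ∈ Set.range g₁ := by
    set D := ((Finset.univ.filter fun i => g₁ i ∉ A).image g₁)ᶜ with hD
    have hAD : A ⊆ D := fun e he => by
      simp only [hD, Finset.mem_compl, Finset.mem_image, Finset.mem_filter, Finset.mem_univ,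
        true_and, not_exists, not_and]
      rintro i hi rfl
      exact hi he
    have hDr : ∀ e ∉ D, e ∈ Set.range g₁ := fun e he => by
      simp only [hD, Finset.mem_compl, not_not, Finset.mem_image] at he
      obtain ⟨i, -, rfl⟩ := he
      exact ⟨i, rfl⟩
    have hiff : ∀ i, g₁ i ∈ D ↔ g₁ i ∈ A := fun i =>
      ⟨fun h => by
        by_contra hi
        exact Finset.mem_compl.1 h (Finset.mem_image_of_mem _ (by simp [hi])), fun h => hAD h⟩
    have hs : sContr M D α = sContr M A α := by
      rw [hdet D (hsub D hDr), hdet A hvA, det_submatrix_val_congr K hiff]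
    have := Finset.eq_of_subset_of_card_le hAD (hmax D (hs ▸ hA))
    rw [this]
    exact hDr
  obtain ⟨hcard, -⟩ := rank_compl_add_card hrep g₁ hg₁ A hvA
  have hsym : K.IsSymm := by
    ext i j
    simp only [hK, transpose_apply, of_apply]
    exact Finset.sum_congr rfl fun e _ => by ring
  have hmain := sum_addChar_quadratic hF hψ hsym (fun i => g₁ i ∈ A)
    (by rw [← hdet A hvA]; exact hA) (fun Q _ hPQ ⟨i₀, hi₀, hi₀'⟩ => by
      set D := A ∪ (Finset.univ.filter Q).image g₁ with hD
      have hiff : ∀ i, Q i ↔ g₁ i ∈ D := fun i => by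
        simp only [hD, Finset.mem_union, Finset.mem_image, Finset.mem_filter, Finset.mem_univ,
          true_and, hinj.eq_iff, exists_eq_right]
        exact ⟨Or.inr, fun h => h.elim (hPQ i) id⟩
      rw [det_submatrix_val_congr K hiff, ← hdet D (hsub D fun e he => hrange e fun h =>
        he (Finset.mem_union_left _ h))]
      by_contra hne
      have hlt : A ⊂ D := Finset.ssubset_iff_subset_ne.2 ⟨Finset.subset_union_left, fun h =>
        hi₀' (h ▸ (hiff i₀).1 hi₀)⟩
      exact absurd (hmax D hne) (not_le.2 (Finset.card_lt_card hlt)))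
  rw [← hdet A hvA, Fintype.card_subtype_compl] at hmain
  have hc1 : Fintype.card κ - Fintype.card {i // g₁ i ∈ A} = M.r Aᶜ := by omega
  have hc2 : M.r Finset.univ - M.r Aᶜ = Fintype.card {i // g₁ i ∈ A} := by omega
  rw [hc1] at hmain
  rw [hc2, ← hmain]
  have hbij : Function.Bijective fun x : κ → F => x ᵥ* G :=
    (vecMul_injective_of_isUnit hG).bijective_of_finite
  rw [← hbij.sum_comp]
  refine Finset.sum_congr rfl fun x _ => ?_
  rw [dotProduct_sum_rank_one]
  simp_rw [hv, dotProduct_mulVec]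

theorem card_filter_dotProduct_eq_zero {F κ : Type*} [Field F] [Fintype F] [DecidableEq F]
    [Fintype κ] [DecidableEq κ] {ρ : Finset E → ℕ} {w : E → κ → F} (hw : IsRep F ρ w)
    (S : Finset E) :
    (Finset.univ.filter fun x : κ → F => ∀ e ∈ S, x ⬝ᵥ w e = 0).card =
      Fintype.card F ^ (Fintype.card κ - ρ S) := by
  classical
  let A : Matrix S κ F := Matrix.of fun e i => w e i
  have hrank : finrank F (LinearMap.range A.mulVecLin) = ρ S := by
    have : Set.range A.row = w '' (S : Set E) := by
      ext x
      constructor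
      · rintro ⟨e, rfl⟩; exact ⟨e, e.2, rfl⟩
      · rintro ⟨e, he, rfl⟩; exact ⟨⟨e, he⟩, rfl⟩
    rw [hw S, ← this, ← rank_eq_finrank_span_row]
    rfl
  have hker : finrank F (LinearMap.ker A.mulVecLin) = Fintype.card κ - ρ S := by
    have := LinearMap.finrank_range_add_finrank_ker A.mulVecLin
    rw [hrank, Module.finrank_fintype_fun_eq_card] at this
    omega
  rw [← hker, ← Module.card_eq_pow_finrank, Fintype.card_subtype]
  congr 1
  ext x
  simp only [Finset.mem_filter, Finset.mem_univ, true_and, LinearMap.mem_ker, mulVecLin_apply]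
  constructor
  · intro h
    ext e
    rw [mulVec, dotProduct_comm]
    exact h e e.2
  · intro h e he
    rw [dotProduct_comm]
    exact congrFun h ⟨e, he⟩

theorem sum_filter_ne_zero_addChar {F R : Type*} [Field F] [Fintype F] [DecidableEq F] [Field R]
    {ψ : AddChar F R} (hψ : ψ.IsPrimitive) (t : F) :
    ∑ a ∈ Finset.univ.filter (fun a : F => a ≠ 0), ψ (a * t ^ 2) =
      (if t = 0 then (Fintype.card F : R) else 0) + -1 := by
  have h := AddChar.sum_mulShift (t ^ 2) hψ
  rw [← Finset.add_sum_erase _ _ (Finset.mem_univ (0 : F))] at h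
  simp only [zero_mul, AddChar.map_zero_eq_one, sq_eq_zero_iff] at h
  rw [Finset.filter_ne', ← sub_eq_add_neg, eq_sub_iff_add_eq, add_comm, h]
  split_ifs <;> simp

theorem dualR_univ_sub (M : Matroid E) (A : Finset E) :
    M.r Finset.univ + (dualR M Finset.univ - dualR M A) =
      Aᶜ.card + (M.r Finset.univ - M.r Aᶜ) := by
  have h1 := M.r_le_card ∅
  have h2 := M.r_submod Aᶜ A
  have h3 := M.r_le_card A
  have h4 := M.r_le_card Aᶜ
  have h5 := M.r_mono (Finset.subset_univ Aᶜ)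
  have h6 := Finset.card_compl_add_card A
  rw [Finset.union_comm, Finset.union_compl] at h2
  rw [dualR, dualR, Finset.compl_univ, Finset.card_univ]
  rw [Finset.card_empty] at h1
  omega

theorem sum_sum_addChar_eq_charPolyVal {F R κ : Type*} [Field F] [Fintype F] [DecidableEq F]
    [Field R] [CharZero R] [Fintype κ] [DecidableEq κ] {ψ : AddChar F R} (hψ : ψ.IsPrimitive)
    {M : Matroid E} {w : E → κ → F} (hw : IsRep F M.r w)
    (hr : M.r Finset.univ = Fintype.card κ) :
    ∑ α ∈ Finset.univ.filter (fun α : E → F => ∀ e, α e ≠ 0),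
        ∑ x : κ → F, ψ (∑ e, α e * (x ⬝ᵥ w e) ^ 2) =
      (Fintype.card F : R) ^ M.r Finset.univ *
        ((charPolyVal (dualR M) (Fintype.card F) : ℚ) : R) := by
  have hpi : Finset.univ.filter (fun α : E → F => ∀ e, α e ≠ 0) =
      Fintype.piFinset fun _ => Finset.univ.filter fun a : F => a ≠ 0 := by
    ext α
    simp
  have hx : ∀ x : κ → F, ∑ α ∈ Finset.univ.filter (fun α : E → F => ∀ e, α e ≠ 0),
      ψ (∑ e, α e * (x ⬝ᵥ w e) ^ 2) = ∑ A : Finset E, (-1 : R) ^ A.card *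
        ((Fintype.card F : R) ^ Aᶜ.card * if ∀ e ∈ Aᶜ, x ⬝ᵥ w e = 0 then 1 else 0) := fun x => by
    simp_rw [addChar_map_sum]
    rw [hpi, ← Finset.prod_univ_sum (fun _ => Finset.univ.filter fun a : F => a ≠ 0)
      (fun e a => ψ (a * (x ⬝ᵥ w e) ^ 2))]
    simp_rw [sum_filter_ne_zero_addChar hψ]
    rw [Fintype.prod_add]
    refine Fintype.sum_bijective (fun A : Finset E => Aᶜ) compl_bijective _ _ fun A => ?_
    rw [Finset.prod_ite_zero, Finset.prod_const, Finset.prod_const, compl_compl, mul_ite,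
      mul_one, mul_zero, mul_comm]
    congr
  rw [Finset.sum_comm]
  simp_rw [hx]
  rw [Finset.sum_comm, charPolyVal, Rat.cast_sum, Finset.mul_sum]
  refine Finset.sum_congr rfl fun A _ => ?_
  rw [← Finset.mul_sum, ← Finset.mul_sum, Finset.sum_boole,
    card_filter_dotProduct_eq_zero hw, ← hr]
  push_cast
  rw [← pow_add, ← dualR_univ_sub, pow_add]
  ring

theorem gaussSum_pow_add_neg_pow {F R : Type} [Field F] [Fintype F] [DecidableEq F] [Field R]
    [CharZero R] {G : R} (hG : G ^ 2 = ((quadraticChar F (-1) : ℤ) : R) * Fintype.card F) (m : ℕ) :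
    G ^ m + (-G) ^ m = 2 * (Fintype.card F : R) ^ m * ((g F m : ℚ) : R) := by
  have hq : (Fintype.card F : R) ≠ 0 := Nat.cast_ne_zero.2 Fintype.card_ne_zero
  rw [g]
  split_ifs with hm
  · obtain ⟨k, rfl⟩ := hm
    rw [← two_mul, pow_mul, pow_mul, neg_sq, hG, Nat.mul_div_cancel_left _ two_pos]
    push_cast
    rw [mul_pow, inv_pow, two_mul k, pow_add]
    field_simp
    ring
  · rw [(Nat.not_even_iff_odd.1 hm).neg_pow]
    simp

theorem card_pow_mul_charPolyVal {F : Type} {R : Type*} [Field F] [Fintype F] [DecidableEq F]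
    [Field R] [CharZero R] (hF : ringChar F ≠ 2) {ψ : AddChar F R} (hψ : ψ.IsPrimitive)
    {M : Matroid E} (hM : Regular M) (Astar : (E → F) → Finset E)
    (hne : ∀ α : E → F, (∀ e, α e ≠ 0) → sContr M (Astar α) α ≠ 0)
    (hmax : ∀ α : E → F, (∀ e, α e ≠ 0) →
      ∀ A : Finset E, sContr M A α ≠ 0 → A.card ≤ (Astar α).card) :
    (Fintype.card F : R) ^ M.r Finset.univ * ((charPolyVal (dualR M) (Fintype.card F) : ℚ) : R) =
      ∑ α ∈ Finset.univ.filter (fun α : E → F => ∀ e, α e ≠ 0),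
        (Fintype.card F : R) ^ M.r (Astar α)ᶜ *
          (((quadraticChar F (sContr M (Astar α) α) : ℤ) : R) *
            gaussSum ((quadraticChar F).ringHomComp (Int.castRingHom R)) ψ ^
              (M.r Finset.univ - M.r (Astar α)ᶜ)) := by
  obtain ⟨w, hw, hU⟩ := exists_isUnimodular hM rfl F
  have hr : M.r Finset.univ = Fintype.card (Fin (M.r Finset.univ)) := by simp
  rw [← sum_sum_addChar_eq_charPolyVal hψ hw hr]
  refine Finset.sum_congr rfl fun α hα => ?_
  have hα' := (Finset.mem_filter.1 hα).2
  exact sum_addChar_eq_gaussSum hF hψ hw hU hr α _ (hne α hα') (hmax α hα')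

/-- **Theorem 3 of the paper.**  Let `q = p^d`, `p` an odd prime, and let `M` be a
regular matroid without coloops on `E`.  For each everywhere-nonzero `α : E → 𝔽_q`
let `A*_⊥(α)` be any subset of maximal cardinality among the `A ⊆ E` with
`s(M.A;α) ≠ 0`.  Then, with `r(M.A) = r(E) − r(E∖A)`,
`χ_{M✶}(q) = ∑_α g(q, r(M.A*_⊥(α))) · η(s(M.A*_⊥(α);α))`. -/
theorem alpha_representation_dual_charPoly
    (E : Type) [Fintype E] [DecidableEq E]
    (F : Type) [Field F] [Fintype F] [DecidableEq F]
    (p d : ℕ) (hp : p.Prime) (hpodd : Odd p) (hcard : Fintype.card F = p ^ d)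
    (M : Matroid E)
    (hregular : Regular M)
    (hcoloopless : ∀ e : E, ¬ IsColoop M e)
    (Astar : (E → F) → Finset E)
    (hAstar_ne : ∀ α : E → F, (∀ e, α e ≠ 0) → sContr M (Astar α) α ≠ 0)
    (hAstar_max : ∀ α : E → F, (∀ e, α e ≠ 0) →
      ∀ A : Finset E, sContr M A α ≠ 0 → A.card ≤ (Astar α).card) :
    charPolyVal (dualR M) (Fintype.card F) =
      ∑ α ∈ Finset.univ.filter (fun α : E → F => ∀ e, α e ≠ 0),
        g F (M.r Finset.univ - M.r (Astar α)ᶜ) *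
          ((quadraticChar F (sContr M (Astar α) α) : ℤ) : ℚ) := by
  have hF : ringChar F ≠ 2 := fun h => by
    have h0 := FiniteField.even_card_iff_char_two.1 h
    have h1 := Nat.odd_iff.1 (hpodd.pow (n := d))
    omega
  set ψ := AddChar.FiniteField.primitiveChar_to_Complex F
  have hψ : ψ.IsPrimitive := AddChar.FiniteField.primitiveChar_to_Complex_isPrimitive F
  obtain ⟨c, hc⟩ := quadraticChar_exists_neg_one' hF
  have hψc : (ψ.mulShift (c : F)).IsPrimitive := fun a ha => by
    rw [AddChar.mulShift_mulShift]
    exact hψ (mul_ne_zero c.ne_zero ha)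
  set χ := (quadraticChar F).ringHomComp (Int.castRingHom ℂ) with hχ
  have hχa : ∀ b, χ b = ((quadraticChar F b : ℤ) : ℂ) := fun b => rfl
  have hGc : gaussSum χ (ψ.mulShift (c : F)) = -gaussSum χ ψ := by
    rw [← gaussSum_mulShift χ ψ c, hχa, hc]
    simp
  have hG : gaussSum χ ψ ^ 2 = ((quadraticChar F (-1) : ℤ) : ℂ) * Fintype.card F := by
    have hχ1 : χ ≠ 1 := fun h => by
      have h1 := hχa c
      rw [h, hc, MulChar.one_apply_coe] at h1
      norm_num at h1
    rw [gaussSum_sq hχ1 ((quadraticChar_isQuadratic F).comp _) hψ, hχa]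
  have h1 := card_pow_mul_charPolyVal hF hψ hregular Astar hAstar_ne hAstar_max
  have h2 := card_pow_mul_charPolyVal hF hψc hregular Astar hAstar_ne hAstar_max
  rw [← hχ] at h1 h2
  rw [hGc] at h2
  have hq : (Fintype.card F : ℂ) ≠ 0 := Nat.cast_ne_zero.2 Fintype.card_ne_zero
  have h3 := congrArg₂ (· + ·) h1 h2
  simp only [← two_mul, ← Finset.sum_add_distrib] at h3
  apply Rat.cast_injective (α := ℂ)
  refine mul_left_cancel₀ (mul_ne_zero two_ne_zero
    (pow_ne_zero (M.r Finset.univ) hq)) ?_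
  rw [mul_assoc, h3, Rat.cast_sum, Finset.mul_sum]
  refine Finset.sum_congr rfl fun α _ => ?_
  rw [← mul_add, ← mul_add, gaussSum_pow_add_neg_pow hG,
    ← Nat.add_sub_cancel' (M.r_mono (Finset.subset_univ (Astar α)ᶜ)), pow_add,
    Nat.add_sub_cancel_left]
  push_cast
  ring

end AlphaRepr
end

section
/- Let q be odd and let C and D be symmetric n×n matrices over 𝔽_q with D = P C Pᵀ for some invertible n×n matrix P over 𝔽_q. Then rank D = rank C =: r, and for any principal r×r submatrices C_r of C and D_r of D with det C_r ≠ 0 and det D_r ≠ 0 one has η(det D_r) = η(det C_r). In particular, in the α-representation for a representable matroid, every summand g(q,r*(α))·η(s'(𝙼/W*(α);α)) is unchanged when the representation matrix 𝙼 is replaced by P𝙼 for any invertible matrix P. -/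
/-!
STATEMENT 16: congruent symmetric matrices over `𝔽_q` (`q` odd) have the same
rank and the same quadratic character of nonsingular principal minors of
maximal order; in particular, the summands of the α-representation are
unchanged when the representation matrix `𝙼` is replaced by `P𝙼` with `P`
invertible.
-/

namespace AlphaRepr

variable {V E F : Type} [Fintype V] [Fintype E] [DecidableEq V] [DecidableEq E] [Field F]

/-- The determinant of the square submatrix of `Mx` on rows `R` and columns `C`
(enumerating `R` and `C` via `Finset.equivFin`); `0` when `|C| ≠ |R|`.
Its square `sdet² = det(Mx|_B)²` is independent of the enumeration. -/
noncomputable def sdet (Mx : Matrix V E F) (R : Finset V) (C : Finset E) : F :=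
  if h : C.card = R.card then
    Matrix.det (Matrix.of fun i j : Fin R.card =>
      Mx (↑(R.equivFin.symm i)) (↑(C.equivFin.symm (Fin.cast h.symm j))))
  else 0

/-- `s'(𝙼/W;α) = ∑_{B, |B| = |V∖W|} det((𝙼/W)|_B)² ∏_{e∈B} α_e`, where `𝙼/W` is
`𝙼` with the rows in `W` deleted. -/
noncomputable def sprime (Mx : Matrix V E F) (W : Finset V) (α : E → F) : F :=
  ∑ B ∈ Finset.univ.filter (fun B : Finset E => B.card = Wᶜ.card),
    (sdet Mx Wᶜ B) ^ 2 * ∏ e ∈ B, α e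

open Matrix Finset

section CauchyBinet

variable {ι E R : Type*} [Fintype ι] [DecidableEq ι] [Fintype E] [CommRing R]

/-- Row expansion of the determinant of a product of rectangular matrices. -/
lemma det_mul_eq_sum_fun (A : Matrix ι E R) (B : Matrix E ι R) :
    (A * B).det = ∑ f : ι → E, (∏ i, A i (f i)) * (B.submatrix f id).det := by
  have h : A * B = fun i => ∑ e, A i e • B e := by
    ext i j
    simp [mul_apply, Finset.sum_apply]
  rw [h]
  change detRowAlternating.toMultilinearMap _ = _
  rw [MultilinearMap.map_sum]
  refine sum_congr rfl fun f _ => ?_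
  rw [MultilinearMap.map_smul_univ]
  rfl

variable [DecidableEq E]

/-- The terms of the row expansion indexed by the functions with image `C` add up to a product of
two maximal minors. -/
lemma sum_fun_image_eq (A : Matrix ι E R) (B : Matrix E ι R) (C : Finset E) (c : ι ≃ C) :
    ∑ f : ι → E with univ.image f = C, (∏ i, A i (f i)) * (B.submatrix f id).det =
      (A.submatrix id fun i => (c i : E)).det * (B.submatrix (fun i => (c i : E)) id).det := by
  rw [← det_transpose (A.submatrix id _), det_apply', sum_mul]
  symm
  refine sum_bij (fun (σ : Equiv.Perm ι) _ i => (c (σ i) : E)) ?_ ?_ ?_ ?_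
  · intro σ _
    rw [mem_filter_univ]
    ext e
    simp only [mem_image, mem_univ, true_and]
    constructor
    · rintro ⟨i, rfl⟩
      exact (c (σ i)).2
    · intro he
      exact ⟨σ.symm (c.symm ⟨e, he⟩), by simp⟩
  · intro σ _ τ _ h
    ext i
    exact c.injective (Subtype.ext (congrFun h i))
  · intro f hf
    rw [mem_filter_univ] at hf
    have hm : ∀ i, f i ∈ C := fun i => hf ▸ mem_image_of_mem f (mem_univ i)
    have hs : Function.Surjective fun i => c.symm ⟨f i, hm i⟩ := by
      intro j
      have hj : (c j : E) ∈ univ.image f := hf ▸ (c j).2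
      obtain ⟨i, -, hi⟩ := mem_image.1 hj
      exact ⟨i, by simp [hi]⟩
    exact ⟨Equiv.ofBijective _ (Finite.surjective_iff_bijective.1 hs), mem_univ _, by
      funext i; simp⟩
  · intro σ _
    have h := det_permute σ (B.submatrix (fun i => (c i : E)) id)
    rw [submatrix_submatrix] at h
    rw [show (B.submatrix (fun i => (c (σ i) : E)) id).det = _ from h]
    rw [show ∏ i, (A.submatrix id fun i => (c i : E))ᵀ (σ i) i = ∏ i, A i (c (σ i)) from rfl]
    ring

/-- Functions whose image has the wrong size do not contribute to the row expansion. -/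
lemma sum_fun_image_eq_zero (A : Matrix ι E R) (B : Matrix E ι R) (C : Finset E)
    (hC : C.card ≠ Fintype.card ι) :
    ∑ f : ι → E with univ.image f = C, (∏ i, A i (f i)) * (B.submatrix f id).det = 0 := by
  refine sum_eq_zero fun f hf => ?_
  rw [mem_filter_univ] at hf
  have hinj : ¬ Function.Injective f := fun h => hC (by rw [← hf, card_image_of_injective _ h]; rfl)
  simp only [Function.Injective, not_forall] at hinj
  obtain ⟨i, j, hij, hne⟩ := hinj
  rw [det_zero_of_row_eq hne (by ext k; simp [hij]), mul_zero]

end CauchyBinet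

section Congruence

variable {V ι κ K : Type*} [Fintype V] [Fintype ι] [Field K]

lemma card_le_rank_of_det_submatrix_ne_zero [DecidableEq ι] {C : Matrix V V K} {a : ι → V}
    (h : (C.submatrix a a).det ≠ 0) : Fintype.card ι ≤ C.rank := by
  rw [← rank_of_det_ne_zero h]
  exact rank_submatrix_le C a a

/-- A matrix factors through any set of columns of full rank. -/
lemma exists_eq_submatrix_mul (C : Matrix V V K) (a : ι → V)
    (h : C.rank ≤ (C.submatrix id a).rank) :
    ∃ X : Matrix ι V K, C = C.submatrix id a * X := by
  have hle : Submodule.span K (Set.range (C.submatrix id a).col) ≤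
      Submodule.span K (Set.range C.col) := by
    refine Submodule.span_mono ?_
    rintro _ ⟨i, rfl⟩
    exact ⟨a i, rfl⟩
  have heq := Submodule.eq_of_le_of_finrank_le hle (by
    rwa [← rank_eq_finrank_span_cols, ← rank_eq_finrank_span_cols])
  have hx : ∀ v, ∃ x : ι → K, ∑ i, x i • (C.submatrix id a).col i = C.col v := fun v =>
    (Submodule.mem_span_range_iff_exists_fun K).1
      (heq ▸ Submodule.subset_span (Set.mem_range_self v))
  choose x hx using hx
  refine ⟨of fun i v => x v i, ?_⟩
  ext u v
  have := congrFun (hx v) u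
  simp only [Finset.sum_apply, Pi.smul_apply, smul_eq_mul, col_apply] at this
  rw [← this, mul_apply]
  exact sum_congr rfl fun i _ => mul_comm _ _

/-- A symmetric matrix is congruent to any of its principal submatrices that meet a full-rank set
of columns. -/
lemma exists_eq_transpose_mul_submatrix_mul {C : Matrix V V K} (hC : C.IsSymm) (a : ι → V)
    (h : C.rank ≤ (C.submatrix id a).rank) :
    ∃ X : Matrix ι V K, C = Xᵀ * C.submatrix a a * X := by
  obtain ⟨X, hX⟩ := exists_eq_submatrix_mul C a h
  refine ⟨X, ?_⟩
  have hr : C.submatrix a id = C.submatrix a a * X := by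
    conv_lhs => rw [hX]
    rfl
  have hc : C.submatrix id a = Xᵀ * C.submatrix a a := by
    have := congrArg transpose hr
    rwa [transpose_mul, transpose_submatrix, transpose_submatrix, hC.eq] at this
  rw [← hc]
  exact hX

/-- A symmetric matrix has a nonsingular principal submatrix of maximal order. -/
lemma exists_finset_card_eq_rank_det_ne_zero [DecidableEq V] {C : Matrix V V K} (hC : C.IsSymm) :
    ∃ S : Finset V, S.card = C.rank ∧
      (C.submatrix (fun i : S => (i : V)) (fun i : S => (i : V))).det ≠ 0 := by
  obtain ⟨κ, a, ha, hspan, hli⟩ := exists_linearIndependent' K C.col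
  have : Fintype κ := Fintype.ofInjective a ha
  set S : Finset V := univ.image a with hS
  have hrank : C.rank = (C.submatrix id (fun i : S => (i : V))).rank := by
    rw [rank_eq_finrank_span_cols, rank_eq_finrank_span_cols, ← hspan]
    have hrange : Set.range (C.col ∘ a) = Set.range (C.submatrix id (fun i : S => (i : V))).col := by
      ext x
      constructor
      · rintro ⟨k, rfl⟩
        exact ⟨⟨a k, mem_image_of_mem a (mem_univ k)⟩, rfl⟩
      · rintro ⟨⟨v, hv⟩, rfl⟩
        obtain ⟨k, -, rfl⟩ := mem_image.1 hv
        exact ⟨k, rfl⟩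
    rw [hrange]
  have hcard : S.card = C.rank := by
    rw [hS, card_image_of_injective _ ha, rank_eq_finrank_span_cols, ← hspan,
      finrank_span_eq_card hli]
    rfl
  refine ⟨S, hcard, ?_⟩
  obtain ⟨X, hX⟩ := exists_eq_transpose_mul_submatrix_mul hC _ hrank.le
  have hle : Fintype.card S ≤ (C.submatrix (fun i : S => (i : V)) (fun i : S => (i : V))).rank := by
    rw [Fintype.card_coe, hcard]
    conv_lhs => rw [hX]
    exact (rank_mul_le_left _ _).trans (rank_mul_le_right _ _)
  rw [rank_eq_finrank_span_cols] at hle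
  rw [← isUnit_iff_ne_zero, ← isUnit_iff_isUnit_det, ← linearIndependent_cols_iff_isUnit]
  exact linearIndependent_iff_card_le_finrank_span.2 hle

variable [DecidableEq ι] [Fintype κ] [DecidableEq κ]

/-- Nonsingular principal submatrices of maximal order of congruent symmetric matrices have
determinants that agree up to a nonzero square. -/
lemma exists_det_submatrix_eq_sq_mul {C D P : Matrix V V K} (hC : C.IsSymm)
    (hD : D = P * C * Pᵀ) {a : ι → V} {b : κ → V} (ha : Fintype.card ι = C.rank)
    (hb : Fintype.card κ = C.rank) (hCa : (C.submatrix a a).det ≠ 0)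
    (hDb : (D.submatrix b b).det ≠ 0) :
    ∃ y : K, y ≠ 0 ∧ (D.submatrix b b).det = y ^ 2 * (C.submatrix a a).det := by
  have hrank : C.rank ≤ (C.submatrix id a).rank := by
    rw [← ha, ← rank_of_det_ne_zero hCa]
    exact rank_submatrix_le (C.submatrix id a) a id
  obtain ⟨X, hX⟩ := exists_eq_transpose_mul_submatrix_mul hC a hrank
  let e : κ ≃ ι := Fintype.equivOfCardEq (hb.trans ha.symm)
  set Y : Matrix κ κ K := (P * Xᵀ).submatrix b e with hY
  have hDY : D.submatrix b b = Y * (C.submatrix a a).submatrix e e * Yᵀ := by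
    rw [hY, transpose_submatrix, submatrix_mul_equiv, submatrix_mul_equiv, hD, transpose_mul,
      transpose_transpose]
    conv_lhs => rw [hX]
    simp only [Matrix.mul_assoc]
  have hdet : (D.submatrix b b).det = Y.det ^ 2 * (C.submatrix a a).det := by
    rw [hDY, det_mul, det_mul, det_transpose, det_submatrix_equiv_self]
    ring
  refine ⟨Y.det, ?_, hdet⟩
  intro h0
  exact hDb (by rw [hdet, h0]; ring)

lemma rank_congruent [DecidableEq V] {C P : Matrix V V K} (hP : IsUnit P.det) :
    (P * C * Pᵀ).rank = C.rank := by
  rw [rank_mul_eq_left_of_isUnit_det _ _ (by rwa [det_transpose]),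
    rank_mul_eq_right_of_isUnit_det _ _ hP]

lemma quadraticChar_det_submatrix_eq [Fintype K] [DecidableEq K] {C D P : Matrix V V K}
    (hC : C.IsSymm) (hD : D = P * C * Pᵀ) {a : ι → V} {b : κ → V}
    (ha : Fintype.card ι = C.rank) (hb : Fintype.card κ = C.rank)
    (hCa : (C.submatrix a a).det ≠ 0) (hDb : (D.submatrix b b).det ≠ 0) :
    quadraticChar K (D.submatrix b b).det = quadraticChar K (C.submatrix a a).det := by
  obtain ⟨y, hy, h⟩ := exists_det_submatrix_eq_sq_mul hC hD ha hb hCa hDb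
  rw [h, map_mul, quadraticChar_sq_one' hy, one_mul]

end Congruence

section Summands

variable {V E F : Type} [Fintype V] [Fintype E] [DecidableEq V] [DecidableEq E] [Field F]

/-- `s'(𝙼/W;α)` is the principal minor of `𝙼 diag(α) 𝙼ᵀ` on the complement of `W`. -/
lemma sprime_eq_det (Mx : Matrix V E F) (W : Finset V) (α : E → F) :
    sprime Mx W α = ((Mx * diagonal α * Mxᵀ).submatrix
      (fun i : ↥(Wᶜ) => (i : V)) (fun i : ↥(Wᶜ) => (i : V))).det := by
  let r := (Wᶜ).equivFin.symm
  set A : Matrix (Fin (Wᶜ).card) E F := Mx.submatrix (fun i => (r i : V)) id with hA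
  have hdet : ((Mx * diagonal α * Mxᵀ).submatrix
      (fun i : ↥(Wᶜ) => (i : V)) (fun i : ↥(Wᶜ) => (i : V))).det = (A * (diagonal α * Aᵀ)).det := by
    rw [← det_submatrix_equiv_self r, ← Matrix.mul_assoc]
    rfl
  rw [hdet, det_mul_eq_sum_fun, ← sum_fiberwise univ (fun f => univ.image f), sprime, sum_filter]
  refine sum_congr rfl fun B _ => ?_
  split_ifs with h
  · let c : Fin (Wᶜ).card ≃ B := (finCongr h.symm).trans B.equivFin.symm
    rw [sum_fun_image_eq _ _ B c]
    have hs : sdet Mx Wᶜ B = (A.submatrix id fun i => (c i : E)).det := by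
      rw [sdet, dif_pos h]
      rfl
    have hd : (diagonal α * Aᵀ).submatrix (fun i => (c i : E)) id =
        diagonal (fun i => α (c i)) * (A.submatrix id fun i => (c i : E))ᵀ := by
      ext i j
      simp
    rw [hs, hd, det_mul, det_transpose, det_diagonal, c.prod_comp fun e => α (e : E),
      prod_coe_sort B α]
    ring
  · rw [sum_fun_image_eq_zero _ _ B (by rwa [Fintype.card_fin])]

/-- A minimum-cardinality `W` with `s'(𝙼/W;α) ≠ 0` has a complement of size
`rank (𝙼 diag(α) 𝙼ᵀ)`. -/
lemma card_compl_eq_rank {Mx : Matrix V E F} {α : E → F} {W : Finset V}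
    (hW : sprime Mx W α ≠ 0) (hmin : ∀ W', sprime Mx W' α ≠ 0 → W.card ≤ W'.card) :
    (Wᶜ).card = (Mx * diagonal α * Mxᵀ).rank := by
  refine le_antisymm ?_ ?_
  · rw [sprime_eq_det] at hW
    exact (Fintype.card_coe _).ge.trans (card_le_rank_of_det_submatrix_ne_zero hW)
  · obtain ⟨S, hS, hdet⟩ := exists_finset_card_eq_rank_det_ne_zero
      (show (Mx * diagonal α * Mxᵀ).IsSymm by
        simp [IsSymm, transpose_mul, Matrix.mul_assoc])
    have := hmin Sᶜ (by rw [sprime_eq_det, compl_compl]; exact hdet)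
    rw [← hS, card_compl]
    have := card_compl S
    have := card_le_univ S
    have := card_le_univ W
    omega

end Summands

theorem congruence_invariance
    (F : Type) [Field F] [Fintype F] [DecidableEq F]
    (hq : Odd (Fintype.card F)) :
    -- congruent symmetric matrices: equal rank and equal `η` of nonsingular
    -- principal minors of maximal order
    (∀ (n : ℕ) (C D P : Matrix (Fin n) (Fin n) F), C.IsSymm →
      IsUnit P.det → D = P * C * P.transpose →
      D.rank = C.rank ∧
      ∀ (S T : Finset (Fin n)), S.card = C.rank → T.card = C.rank →
        (C.submatrix (fun i : S => (i : Fin n)) (fun j : S => (j : Fin n))).det ≠ 0 →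
        (D.submatrix (fun i : T => (i : Fin n)) (fun j : T => (j : Fin n))).det ≠ 0 →
        quadraticChar F
            ((D.submatrix (fun i : T => (i : Fin n)) (fun j : T => (j : Fin n))).det) =
          quadraticChar F
            ((C.submatrix (fun i : S => (i : Fin n)) (fun j : S => (j : Fin n))).det))
    ∧
    -- in particular: the α-representation summands are invariant under 𝙼 ↦ P𝙼
    (∀ (V E : Type) [Fintype V] [Fintype E] [DecidableEq V] [DecidableEq E]
        (Mx : Matrix V E F) (P : Matrix V V F), IsUnit P.det →
      ∀ α : E → F, (∀ e, α e ≠ 0) →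
      ∀ W₁ W₂ : Finset V,
        sprime Mx W₁ α ≠ 0 →
        (∀ W : Finset V, sprime Mx W α ≠ 0 → W₁.card ≤ W.card) →
        sprime (P * Mx) W₂ α ≠ 0 →
        (∀ W : Finset V, sprime (P * Mx) W α ≠ 0 → W₂.card ≤ W.card) →
        g F (Fintype.card V - W₁.card) *
            ((quadraticChar F (sprime Mx W₁ α) : ℤ) : ℚ) =
          g F (Fintype.card V - W₂.card) *
            ((quadraticChar F (sprime (P * Mx) W₂ α) : ℤ) : ℚ)) := by
  constructor
  · rintro n C D P hC hP rfl
    refine ⟨rank_congruent hP, fun S T hS hT hCS hDT => ?_⟩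
    exact quadraticChar_det_submatrix_eq hC rfl (by simpa using hS) (by simpa using hT) hCS hDT
  · intro V E _ _ _ _ Mx P hP α _ W₁ W₂ h₁ hmin₁ h₂ hmin₂
    have hC : (Mx * diagonal α * Mxᵀ).IsSymm := by
      simp [IsSymm, transpose_mul, Matrix.mul_assoc]
    have hD : P * Mx * diagonal α * (P * Mx)ᵀ = P * (Mx * diagonal α * Mxᵀ) * Pᵀ := by
      simp only [transpose_mul, Matrix.mul_assoc]
    have hc₁ := card_compl_eq_rank h₁ hmin₁
    have hc₂ := card_compl_eq_rank h₂ hmin₂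
    rw [hD, rank_congruent hP] at hc₂
    rw [← card_compl, ← card_compl, hc₁, hc₂]
    rw [sprime_eq_det] at h₁ h₂ ⊢
    rw [sprime_eq_det]
    rw [quadraticChar_det_submatrix_eq hC hD ((Fintype.card_coe _).trans hc₁)
      ((Fintype.card_coe _).trans hc₂) h₁ h₂]

end AlphaRepr
end
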